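/- arXiv:2206.03435 — 5 statements merged into one kernel-verified Lean document; each statement's English description precedes it below -/
import Mathlib

section
/- (Z-equations) Let k, m, n be nonnegative integers with k+m ≤ n, Z an n×(k+m) real matrix, W = Z^T viewed as a (k+m)-dimensional subspace of ℝ^n (i.e., Plücker coordinates of the column span of Z), C a k×n matrix, Y = CZ. Then for any (k+m+1)-element subset A of [n] and any (m−1)-element subset B of [n]: ∑_{i∈A} (−1)^{#i} p_{A∖{i}}(W) ⟨Y, B, i⟩ = 0, where #i is the position of i within the sorted list A, and p_{A∖{i}}(W) is the (k+m)×(k+m) minor of Z on rows A∖{i}. -/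
/-- The twistor coordinate: determinant of the matrix whose first `k` rows are those of `Y`
and whose last `m` rows are the rows `Z_{L b}` of `Z`. -/
noncomputable def twistor {k m n : ℕ} (Z : Matrix (Fin n) (Fin (k + m)) ℝ)
    (Y : Matrix (Fin k) (Fin (k + m)) ℝ) (L : Fin m → Fin n) : ℝ :=
  Matrix.det (Matrix.of fun i j : Fin k ⊕ Fin m =>
    Sum.elim (fun a => Y a) (fun b => Z (L b)) i (finSumFinEquiv j))

/-- The alternating sum, over `N + 1` vectors in `R ^ N`, of a linear functional at one vector
times the determinant of the others vanishes. -/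
theorem sum_neg_one_pow_mul_det_succAbove_mul_linearMap {R : Type*} [CommRing R] {N : ℕ}
    (V : Fin (N + 1) → Fin N → R) (f : (Fin N → R) →ₗ[R] R) :
    ∑ t : Fin (N + 1), (-1 : R) ^ (t : ℕ) *
      Matrix.det (Matrix.of fun a b => V (t.succAbove a) b) * f (V t) = 0 := by
  obtain ⟨c, hf⟩ : ∃ c : Fin N → R, ∀ v, f v = ∑ j, v j * c j :=
    ⟨_, f.pi_apply_eq_sum_univ⟩
  simp_rw [hf (V _), Finset.mul_sum]
  rw [Finset.sum_comm]
  refine Finset.sum_eq_zero fun j _ => ?_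
  -- The coefficient of `c j` is a determinant with a repeated column.
  have hdet : Matrix.det (Matrix.of fun t => (Fin.cons (V t j) (V t) : Fin (N + 1) → R)) = 0 :=
    Matrix.det_zero_of_column_eq (Fin.succ_ne_zero j).symm fun t => by simp
  rw [Matrix.det_succ_column_zero] at hdet
  rw [← zero_mul (c j), ← hdet, Finset.sum_mul]
  refine Finset.sum_congr rfl fun t _ => ?_
  have hsub : (Matrix.of fun t => (Fin.cons (V t j) (V t) : Fin (N + 1) → R)).submatrix
      t.succAbove Fin.succ = Matrix.of fun a b => V (t.succAbove a) b := by
    ext a b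
    simp
  rw [hsub]
  simp only [Matrix.of_apply, Fin.cons_zero]
  ring

/-- The twistor coordinate is linear in its last row. -/
theorem exists_linearMap_twistor_snoc {k m n : ℕ} (Z : Matrix (Fin n) (Fin (k + (m + 1))) ℝ)
    (Y : Matrix (Fin k) (Fin (k + (m + 1))) ℝ) (B : Fin m → Fin n) :
    ∃ f : (Fin (k + (m + 1)) → ℝ) →ₗ[ℝ] ℝ, ∀ i, twistor Z Y (Fin.snoc B i) = f (Z i) := by
  let M : Matrix (Fin k ⊕ Fin (m + 1)) (Fin k ⊕ Fin (m + 1)) ℝ := Matrix.of fun r c =>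
    Sum.elim (fun a => Y a)
      (Fin.snoc (α := fun _ => Fin (k + (m + 1)) → ℝ) (fun b => Z (B b)) 0) r (finSumFinEquiv c)
  refine ⟨(Matrix.detRowAlternating.toMultilinearMap.toLinearMap M (Sum.inr (Fin.last m))).comp
    (LinearMap.funLeft ℝ ℝ finSumFinEquiv), fun i => ?_⟩
  change _ = Matrix.det (M.updateRow (Sum.inr (Fin.last m)) _)
  rw [twistor]
  congr 1
  ext r c
  rcases r with a | b
  · simp [M, Matrix.updateRow_apply]
  · induction b using Fin.lastCases with
    | last => simp [Matrix.updateRow_apply, LinearMap.funLeft_apply]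
    | cast b => simp [M, Matrix.updateRow_apply, (Fin.castSucc_lt_last b).ne]

/-- The `Z`-equations: for a `(k+m+1)`-subset `A` of `[n]` (a strictly increasing list) and
an `(m-1)`-subset `B`, `∑_{i ∈ A} (-1)^{#i} p_{A∖{i}}(W) ⟨Y, B, i⟩ = 0`, where `Y = C Z`,
`#i` is the (1-indexed) position of `i` in `A`, and `p_{A∖{i}}(W)` is the maximal minor of
`Z` on the rows `A∖{i}`.  Here the paper's `m` is `m+1`. -/
theorem stmt2 (k m n : ℕ) (hmn : (k + (m + 1)) + 1 ≤ n)
    (Z : Matrix (Fin n) (Fin (k + (m + 1))) ℝ)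
    (C : Matrix (Fin k) (Fin n) ℝ)
    (A : Fin ((k + (m + 1)) + 1) → Fin n) (hA : StrictMono A)
    (B : Fin m → Fin n) (hB : StrictMono B) :
    ∑ t : Fin ((k + (m + 1)) + 1),
      (-1 : ℝ) ^ ((t : ℕ) + 1) *
        Matrix.det (Matrix.of fun a b : Fin (k + (m + 1)) => Z (A (t.succAbove a)) b) *
        twistor Z (C * Z) (Fin.snoc B (A t)) = 0 := by
  obtain ⟨f, hf⟩ := exists_linearMap_twistor_snoc Z (C * Z) B
  simp_rw [hf, pow_succ, mul_neg_one, neg_mul, Finset.sum_neg_distrib]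
  rw [sum_neg_one_pow_mul_det_succAbove_mul_linearMap (fun t => Z (A t)) f, neg_zero]
end

section
/- Let m = 2r−1 be odd, k, n with k+m ≤ n, Z an n×(k+m) matrix with positive maximal minors, C a k×n matrix with positive maximal minors, Y = CZ. Let B = (b_1, b_1+1, ..., b_{r−1}, b_{r−1}+1) ⊂ [n]. Then the sequence (⟨Y, B, i⟩)_{i=1,...,n} changes sign (ignoring zeros) exactly k times. -/
def PosMaximalMinors {n p : ℕ} (Z : Matrix (Fin n) (Fin p) ℝ) : Prop :=
  ∀ f : Fin p → Fin n, StrictMono f → 0 < Matrix.det (Matrix.of fun a b => Z (f a) b)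

def PosRowMinors {k n : ℕ} (C : Matrix (Fin k) (Fin n) ℝ) : Prop :=
  ∀ g : Fin k → Fin n, StrictMono g → 0 < Matrix.det (Matrix.of fun a b => C a (g b))

def ConsecPairs {m n : ℕ} (I : Fin m → Fin n) : Prop :=
  ∀ a b : Fin m, (a : ℕ) + 1 = (b : ℕ) → (a : ℕ) % 2 = 0 → (I b : ℕ) = (I a : ℕ) + 1

/-- The number of sign changes of a list of reals, ignoring zeros. -/
noncomputable def signFlips (l : List ℝ) : ℕ :=
  let l' := l.filter fun x => decide (x ≠ 0)
  (l'.zip l'.tail).countP fun p => decide (p.1 * p.2 < 0)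

open Finset in
/-- The rank of the `a`-th element of a finite set, counted from below. -/
lemma card_filter_lt_orderEmbOfFin {n c : ℕ} (S : Finset (Fin n)) (h : #S = c) (a : Fin c) :
    #{s ∈ S | s < S.orderEmbOfFin h a} = a := by
  have : {s ∈ S | s < S.orderEmbOfFin h a} =
      (Iio a).map (S.orderEmbOfFin h).toEmbedding := by
    ext s
    simp only [mem_filter, mem_map, mem_Iio, RelEmbedding.coe_toEmbedding]
    constructor
    · rintro ⟨hs, hlt⟩
      obtain ⟨b, rfl⟩ : s ∈ Set.range (S.orderEmbOfFin h) := by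
        rw [range_orderEmbOfFin]; exact hs
      exact ⟨b, (S.orderEmbOfFin h).lt_iff_lt.1 hlt, rfl⟩
    · rintro ⟨b, hb, rfl⟩
      exact ⟨orderEmbOfFin_mem S h b, (S.orderEmbOfFin h).lt_iff_lt.2 hb⟩
  rw [this, card_map, Fin.card_Iio]

open Finset in
/-- A finite set has initial segments of every smaller cardinality. -/
lemma exists_initial_segment {n : ℕ} (J : Finset (Fin n)) (c : ℕ) (hc : c ≤ #J) :
    ∃ K ⊆ J, #K = c ∧ ∀ j ∈ K, {s ∈ K | s < j} = {s ∈ J | s < j} := by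
  induction J using Finset.induction_on_max with
  | empty => exact ⟨∅, by simp, (by simpa using hc : c = 0).symm, by simp⟩
  | insert a J ha ih =>
    have haJ : a ∉ J := fun h => lt_irrefl _ (ha a h)
    rw [card_insert_of_notMem haJ] at hc
    rcases hc.lt_or_eq with h | h
    · obtain ⟨K, hKJ, hK, hs⟩ := ih (by lia)
      refine ⟨K, hKJ.trans (subset_insert _ _), hK, fun j hj => ?_⟩
      rw [hs j hj, filter_insert, if_neg (ha j (hKJ hj)).le.not_gt]
    · exact ⟨insert a J, subset_rfl, by rw [card_insert_of_notMem haJ, h], fun _ _ => rfl⟩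

open Finset in
/-- A subset `T` of `U` can be enlarged inside `U` by elements lying above everything left out. -/
lemma exists_extension_from_top {n : ℕ} {T U : Finset (Fin n)} (hTU : T ⊆ U) {c : ℕ}
    (hT : #T ≤ c) (hU : c ≤ #U) :
    ∃ S, T ⊆ S ∧ S ⊆ U ∧ #S = c ∧ ∀ e ∈ S, e ∉ T → ∀ j ∈ U, j ∉ S → j < e := by
  induction c, hT using Nat.le_induction with
  | base => exact ⟨T, subset_rfl, hTU, rfl, fun e he he' => absurd he he'⟩
  | succ c _ ih =>
    obtain ⟨S, hTS, hSU, hS, hlt⟩ := ih (by lia)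
    have hne : (U \ S).Nonempty := by
      rw [← card_pos, card_sdiff_of_subset hSU]; lia
    have hmem := mem_sdiff.1 ((U \ S).max'_mem hne)
    refine ⟨insert ((U \ S).max' hne) S, hTS.trans (subset_insert _ _),
      insert_subset hmem.1 hSU, by rw [card_insert_of_notMem hmem.2, hS], ?_⟩
    intro e he heT j hj hjS
    rw [mem_insert, not_or] at hjS
    rcases mem_insert.1 he with rfl | he
    · exact lt_of_le_of_ne ((U \ S).le_max' j (mem_sdiff.2 ⟨hj, hjS.2⟩)) hjS.1
    · exact hlt e he heT j hj hjS.2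

lemma signFlips_cons_zero (l : List ℝ) : signFlips (0 :: l) = signFlips l := by
  simp [signFlips]

lemma signFlips_cons {a b : ℝ} (ha : a ≠ 0) {l : List ℝ}
    (hb : (l.filter fun x => decide (x ≠ 0)).head? = some b) :
    signFlips (a :: l) = signFlips l + if a * b < 0 then 1 else 0 := by
  obtain ⟨t, ht⟩ := List.head?_eq_some_iff.1 hb
  simp only [signFlips, List.filter_cons, ht]
  simp [ha, List.countP_cons]

open Finset in
/-- The blocks of constant sign of a sequence with a nonzero term: `T` consists of the last
nonzero position of every block but the final one, and `m` is that position in the final block. -/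
lemma exists_sign_blocks {n : ℕ} (f : Fin n → ℝ) (L : List (Fin n)) (hL : L.Pairwise (· < ·))
    (hf : ∃ j ∈ L, f j ≠ 0) :
    ∃ (ε : ℝ) (T : Finset (Fin n)) (m : Fin n), ε ≠ 0 ∧ #T = signFlips (L.map f) ∧
      (∀ t ∈ T, t ∈ L) ∧ m ∈ L ∧ (∀ t ∈ T, t < m) ∧
      (∀ t ∈ T, 0 < ε * (-1) ^ #{s ∈ T | s < t} * f t) ∧
      0 < ε * (-1) ^ #T * f m ∧ (∀ j ∈ L, 0 ≤ ε * (-1) ^ #{s ∈ T | s < j} * f j) ∧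
      ∃ b, ((L.map f).filter fun x => decide (x ≠ 0)).head? = some b ∧ 0 < ε * b := by
  induction L with
  | nil => simp at hf
  | cons a L ih =>
    obtain ⟨haL, hL⟩ := List.pairwise_cons.1 hL
    by_cases hex : ∃ j ∈ L, f j ≠ 0
    · obtain ⟨ε, T, m, hε, hT, hTL, hmL, hTm, hpos, hm, hall, b, hb, hεb⟩ := ih hL hex
      have hcount : #{s ∈ T | s < a} = 0 := by
        rw [card_eq_zero, filter_eq_empty_iff]
        exact fun {t} ht => (haL t (hTL t ht)).le.not_gt
      by_cases ha : f a = 0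
      · refine ⟨ε, T, m, hε, ?_, fun t ht => List.mem_cons_of_mem _ (hTL t ht),
          List.mem_cons_of_mem _ hmL, hTm, hpos, hm,
          ?_, b, by simpa [ha] using hb, hεb⟩
        · rw [List.map_cons, ha, signFlips_cons_zero, hT]
        · intro j hj
          rcases List.mem_cons.1 hj with rfl | hj
          · simp [ha]
          · exact hall j hj
      · have hflip := signFlips_cons ha hb
        have hhead : (((a :: L).map f).filter fun x => decide (x ≠ 0)).head? = some (f a) := by
          simp [ha]
        have hεsq : 0 < ε ^ 2 := by positivity
        by_cases hab : f a * b < 0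
        · have haT : a ∉ T := fun h => lt_irrefl _ (haL a (hTL a h))
          have hsucc : ∀ j ∈ L, #{s ∈ insert a T | s < j} = #{s ∈ T | s < j} + 1 := by
            intro j hj
            rw [filter_insert, if_pos (haL j hj), card_insert_of_notMem (by simp [haT])]
          have hεa : 0 < -ε * f a := by
            by_contra! h
            nlinarith [mul_nonneg (neg_nonneg.2 h) hεb.le]
          have hcount' : #{s ∈ insert a T | s < a} = 0 := by
            rw [filter_insert, if_neg (lt_irrefl a), hcount]
          refine ⟨-ε, insert a T, m, neg_ne_zero.2 hε, ?_, ?_, List.mem_cons_of_mem _ hmL, ?_, ?_,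
            ?_, ?_, f a, hhead, hεa⟩
          · rw [card_insert_of_notMem haT, hT, List.map_cons, hflip, if_pos hab]
          · intro t ht
            rcases mem_insert.1 ht with rfl | ht
            · exact List.mem_cons_self
            · exact List.mem_cons_of_mem _ (hTL t ht)
          · intro t ht
            rcases mem_insert.1 ht with rfl | ht
            · exact haL m hmL
            · exact hTm t ht
          · intro t ht
            rcases mem_insert.1 ht with rfl | ht
            · simpa [hcount'] using hεa
            · rw [hsucc t (hTL t ht), pow_succ]
              linarith [hpos t ht]
          · rw [card_insert_of_notMem haT, pow_succ]
            linarith [hm]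
          · intro j hj
            rcases List.mem_cons.1 hj with rfl | hj
            · simpa [hcount'] using hεa.le
            · rw [hsucc j hj, pow_succ]
              linarith [hall j hj]
        · have hεa : 0 < ε * f a := by
            have hb0 : b ≠ 0 := right_ne_zero_of_mul hεb.ne'
            have : 0 < f a * b := lt_of_le_of_ne (not_lt.1 hab) (mul_ne_zero ha hb0).symm
            by_contra! h
            nlinarith [mul_nonneg (neg_nonneg.2 h) hεb.le]
          refine ⟨ε, T, m, hε, ?_, fun t ht => List.mem_cons_of_mem _ (hTL t ht),
            List.mem_cons_of_mem _ hmL, hTm, hpos, hm, ?_, f a, hhead, hεa⟩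
          · rw [hT, List.map_cons, hflip, if_neg hab, add_zero]
          · intro j hj
            rcases List.mem_cons.1 hj with rfl | hj
            · simpa [hcount] using hεa.le
            · exact hall j hj
    · push Not at hex
      have ha : f a ≠ 0 := by
        obtain ⟨j, hj, hj0⟩ := hf
        rcases List.mem_cons.1 hj with rfl | hj
        · exact hj0
        · exact absurd (hex j hj) hj0
      have hnil : (L.map f).filter (fun x => decide (x ≠ 0)) = [] := by
        simpa [List.filter_eq_nil_iff] using hex
      have hsq : 0 < f a * f a := mul_self_pos.2 ha
      refine ⟨f a, ∅, a, ha, ?_, by simp, List.mem_cons_self, by simp, by simp, by simpa using hsq,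
        ?_, f a, by simp [ha], hsq⟩
      · simp only [signFlips, List.map_cons, List.filter_cons, hnil]
        simp [ha]
      · intro j hj
        rcases List.mem_cons.1 hj with rfl | hj
        · simpa using hsq.le
        · simp [hex j hj]

open Finset in
/-- The linear relation between `p + 1` vectors of length `p` with maximal minors as weights. -/
lemma sum_minor_smul_row_eq_zero {p : ℕ} (M : Matrix (Fin (p + 1)) (Fin p) ℝ) :
    ∑ a : Fin (p + 1), ((-1) ^ (a : ℕ) * (M.submatrix a.succAbove id).det) • M a = 0 := by
  ext c
  have h : (Matrix.of fun a => (Fin.cons (M a c) (M a) : Fin (p + 1) → ℝ)).det = 0 :=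
    Matrix.det_zero_of_column_eq (i := 0) (j := c.succ) (Fin.succ_ne_zero c).symm (by simp)
  rw [Matrix.det_succ_column_zero] at h
  rw [Finset.sum_apply, Pi.zero_apply, ← h]
  refine sum_congr rfl fun a _ => ?_
  have : (Matrix.of fun a => (Fin.cons (M a c) (M a) : Fin (p + 1) → ℝ)).submatrix
      a.succAbove Fin.succ = M.submatrix a.succAbove id := by
    ext; simp
  rw [this]
  simp only [Pi.smul_apply, smul_eq_mul, Matrix.of_apply, Fin.cons_zero]
  ring

open Finset in
/-- The sign of a minor with rows in arbitrary order is the sign of a Vandermonde determinant. -/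
lemma PosMaximalMinors.det_mul_vandermonde_pos {n p : ℕ} {A : Matrix (Fin n) (Fin p) ℝ}
    (hA : PosMaximalMinors A) {L : Fin p → Fin n} (hL : Function.Injective L) :
    0 < (A.submatrix L id).det * (Matrix.vandermonde fun a => ((L a : ℕ) : ℝ)).det := by
  set σ := Tuple.sort L
  have hmono : StrictMono (L ∘ σ) :=
    (Tuple.monotone_sort L).strictMono_of_injective (hL.comp σ.injective)
  have h1 : 0 < ((A.submatrix L id).submatrix σ id).det := hA _ hmono
  have h2 : 0 < ((Matrix.vandermonde fun a => ((L a : ℕ) : ℝ)).submatrix σ id).det := by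
    have : (Matrix.vandermonde fun a => ((L a : ℕ) : ℝ)).submatrix σ id =
        Matrix.vandermonde fun a => (((L ∘ σ) a : ℕ) : ℝ) := rfl
    rw [this, Matrix.det_vandermonde]
    exact prod_pos fun i _ => prod_pos fun j hj =>
      sub_pos.2 (by exact_mod_cast hmono (mem_Ioi.1 hj))
  rw [Matrix.det_permute] at h1 h2
  have h3 := mul_pos h1 h2
  rcases Int.units_eq_one_or (Equiv.Perm.sign σ) with h | h <;> simpa [h] using h3

lemma PosMaximalMinors.det_ne_zero {n p : ℕ} {A : Matrix (Fin n) (Fin p) ℝ}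
    (hA : PosMaximalMinors A) {L : Fin p → Fin n} (hL : Function.Injective L) :
    (A.submatrix L id).det ≠ 0 :=
  left_ne_zero_of_mul (hA.det_mul_vandermonde_pos hL).ne'

open Finset in
/-- The sign of a minor whose first row has index `j` and whose other rows are in order. -/
lemma PosMaximalMinors.neg_one_pow_mul_det_pos {n p : ℕ} {A : Matrix (Fin n) (Fin (p + 1)) ℝ}
    (hA : PosMaximalMinors A) {S : Finset (Fin n)} (hS : #S = p) {j : Fin n} (hj : j ∉ S) :
    0 < (-1) ^ #{s ∈ S | s < j} *
      (A.submatrix (Fin.cons j (S.orderEmbOfFin hS)) id).det := by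
  have hinj : Function.Injective (Fin.cons j (S.orderEmbOfFin hS) : Fin (p + 1) → Fin n) :=
    Fin.cons_injective_iff.2 ⟨by simpa using hj, (S.orderEmbOfFin hS).injective⟩
  have h := hA.det_mul_vandermonde_pos hinj
  rw [Matrix.det_vandermonde, Fin.prod_univ_succ] at h
  simp only [Fin.Ioi_zero_eq_map, Fin.Ioi_succ, prod_map, Fin.coe_succEmb, Fin.cons_zero,
    Fin.cons_succ] at h
  have hpos : 0 < ∏ x, ∏ y ∈ Ioi x,
      (((S.orderEmbOfFin hS y : ℕ) : ℝ) - ((S.orderEmbOfFin hS x : ℕ) : ℝ)) :=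
    prod_pos fun x _ => prod_pos fun y hy =>
      sub_pos.2 (by exact_mod_cast (S.orderEmbOfFin hS).strictMono (mem_Ioi.1 hy))
  have hprod : ∏ x, (((S.orderEmbOfFin hS x : ℕ) : ℝ) - ((j : ℕ) : ℝ)) =
      ∏ s ∈ S, (((s : ℕ) : ℝ) - ((j : ℕ) : ℝ)) := by
    conv_rhs => rw [← S.map_orderEmbOfFin_univ hS, prod_map]
    rfl
  have hsign : 0 < (-1) ^ #{s ∈ S | s < j} * ∏ s ∈ S, (((s : ℕ) : ℝ) - ((j : ℕ) : ℝ)) := by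
    rw [card_filter, ← prod_pow_eq_pow_sum, ← prod_mul_distrib]
    refine prod_pos fun s hs => ?_
    by_cases hlt : s < j
    · have : ((s : ℕ) : ℝ) < ((j : ℕ) : ℝ) := by exact_mod_cast hlt
      simp only [hlt, if_true, pow_one]
      linarith
    · have hne : j ≠ s := fun h => hj (h ▸ hs)
      have : ((j : ℕ) : ℝ) < ((s : ℕ) : ℝ) := by
        exact_mod_cast lt_of_le_of_ne (not_lt.1 hlt) hne
      simp only [hlt, if_false, pow_zero, one_mul]
      linarith
  rw [hprod, ← mul_assoc] at h
  have h' := mul_pos hsign ((mul_pos_iff_of_pos_right hpos).1 h)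
  refine (mul_pos_iff_of_pos_right (mul_self_pos.2 (right_ne_zero_of_mul hsign.ne'))).1
    (h'.trans_eq ?_)
  ring

open Finset in
/-- Linear forms on the rows of a matrix with positive maximal minors, vanishing on an evenly
placed set `B` of rows, cannot alternate in sign on too many further rows. -/
lemma PosMaximalMinors.not_alternating {n p : ℕ} {A : Matrix (Fin n) (Fin p) ℝ}
    (hA : PosMaximalMinors A) (φ : (Fin p → ℝ) →ₗ[ℝ] ℝ) {B : Finset (Fin n)}
    (hB : ∀ j ∉ B, Even #{b ∈ B | b < j}) (hφ : ∀ b ∈ B, φ (A b) = 0) {J : Finset (Fin n)}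
    (hJ : J.Nonempty) {ε : ℝ} (hsign : ∀ j ∈ J, 0 < ε * (-1) ^ #{s ∈ J | s < j} * φ (A j))
    (hcard : #J + #B = p + 1) : False := by
  have hdisj : Disjoint J B := by
    rw [disjoint_left]
    intro j hj hjB
    simpa [hφ j hjB] using hsign j hj
  have hS : #(J ∪ B) = p + 1 := by rw [card_union_of_disjoint hdisj, hcard]
  set L := (J ∪ B).orderEmbOfFin hS with hLdef
  have hrel := congrArg (fun z => ε * φ z) (sum_minor_smul_row_eq_zero (A.submatrix L id))
  simp only [map_sum, map_smul, map_zero, mul_zero, mul_sum, smul_eq_mul] at hrel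
  have hterm : ∀ a, L a ∈ J → 0 < ε * (((-1) ^ (a : ℕ) *
      ((A.submatrix L id).submatrix a.succAbove id).det) * φ ((A.submatrix L id) a)) := by
    intro a ha
    have hminor : 0 < ((A.submatrix L id).submatrix a.succAbove id).det :=
      hA _ (L.strictMono.comp (Fin.strictMono_succAbove a))
    have hrank := card_filter_lt_orderEmbOfFin (J ∪ B) hS a
    rw [← hLdef, filter_union, card_union_of_disjoint
      (disjoint_filter_filter hdisj)] at hrank
    have hpow : (-1 : ℝ) ^ (a : ℕ) = (-1) ^ #{s ∈ J | s < L a} := by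
      rw [← hrank, pow_add, (hB _ (disjoint_left.1 hdisj ha)).neg_one_pow, mul_one]
    rw [hpow]
    refine (mul_pos (hsign _ ha) hminor).trans_eq ?_
    change _ = ε * (_ * φ (A (L a)))
    ring
  obtain ⟨j, hj⟩ := hJ
  obtain ⟨a, ha⟩ : j ∈ Set.range L := by
    rw [hLdef, range_orderEmbOfFin]; exact mem_union_left _ hj
  refine (sum_pos' (fun a _ => ?_) ⟨a, mem_univ a, hterm a (ha ▸ hj)⟩).ne' hrel
  rcases mem_union.1 (orderEmbOfFin_mem (J ∪ B) hS a) with h | h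
  · exact (hterm a h).le
  · have : φ ((A.submatrix L id) a) = 0 := hφ _ h
    simp [this]

open Finset in
/-- Upper bound on the sign changes of a linear form along the rows of a matrix with positive
maximal minors. Some entries may be replaced by zero. -/
lemma PosMaximalMinors.signFlips_add_card_lt {n p : ℕ} {A : Matrix (Fin n) (Fin p) ℝ}
    (hA : PosMaximalMinors A) (φ : (Fin p → ℝ) →ₗ[ℝ] ℝ) {B : Finset (Fin n)}
    (hB : ∀ j ∉ B, Even #{b ∈ B | b < j}) (hφ : ∀ b ∈ B, φ (A b) = 0) (hBp : #B ≤ p)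
    {f : Fin n → ℝ} (hf : ∀ j, f j ≠ 0 → f j = φ (A j)) (hne : ∃ j, f j ≠ 0) :
    signFlips ((List.finRange n).map f) + #B < p := by
  by_contra! hlt
  obtain ⟨ε, T, m, -, hT, -, -, hTm, hpos, hm, -, -⟩ :=
    exists_sign_blocks f (List.finRange n) (List.pairwise_lt_finRange n)
      (hne.imp fun j hj => ⟨List.mem_finRange j, hj⟩)
  have hmT : m ∉ T := fun h => lt_irrefl _ (hTm m h)
  have hJ : ∀ j ∈ insert m T, 0 < ε * (-1) ^ #{s ∈ insert m T | s < j} * f j := by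
    intro j hj
    rcases mem_insert.1 hj with rfl | hj
    · rwa [filter_insert, if_neg (lt_irrefl _), filter_true_of_mem hTm]
    · rw [filter_insert, if_neg (hTm j hj).le.not_gt]
      exact hpos j hj
  obtain ⟨K, hKJ, hK, hKs⟩ := exists_initial_segment (insert m T) (p + 1 - #B)
    (by rw [card_insert_of_notMem hmT, hT]; lia)
  refine hA.not_alternating φ hB hφ (J := K) (ε := ε) (card_pos.1 (by lia)) ?_ (by lia)
  intro j hj
  have h := hJ j (hKJ hj)
  rw [← hKs j hj] at h
  rwa [← hf j (right_ne_zero_of_mul h.ne')]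

open Finset in
/-- A linear relation between few rows of a matrix with positive maximal minors is trivial. -/
lemma PosMaximalMinors.eq_zero_of_support {n p : ℕ} {A : Matrix (Fin n) (Fin p) ℝ}
    (hA : PosMaximalMinors A) (hpn : p ≤ n) {v : Fin n → ℝ} (hv : Matrix.vecMul v A = 0)
    {S : Finset (Fin n)} (hS : #S ≤ p) (hvS : ∀ j ∉ S, v j = 0) : v = 0 := by
  obtain ⟨R, hSR, hR⟩ := exists_superset_card_eq hS (by simpa using hpn)
  set L := R.orderEmbOfFin hR with hLdef
  have hzero : v ∘ L = 0 := by
    refine Matrix.eq_zero_of_vecMul_eq_zero (hA.det_ne_zero L.injective) ?_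
    ext c
    have h := congrFun hv c
    simp only [Matrix.vecMul, dotProduct] at h ⊢
    rw [← h, ← sum_subset (subset_univ R) fun j _ hj => by
      rw [hvS j fun h => hj (hSR h), zero_mul], ← R.map_orderEmbOfFin_univ hR, sum_map]
    rfl
  ext j
  by_cases hj : j ∈ R
  · obtain ⟨a, rfl⟩ : j ∈ Set.range L := by rw [hLdef, range_orderEmbOfFin]; exact hj
    exact congrFun hzero a
  · exact hvS j fun h => hj (hSR h)

open Finset in
/-- Lower bound on the sign changes of a linear relation between the rows of a matrix with positive
maximal minors, away from an evenly placed set `B` of rows. -/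
lemma PosMaximalMinors.eq_zero_of_signFlips_lt {n p : ℕ} {A : Matrix (Fin n) (Fin p) ℝ}
    (hA : PosMaximalMinors A) (hpn : p ≤ n) {v : Fin n → ℝ} (hv : Matrix.vecMul v A = 0)
    {B : Finset (Fin n)} (hB : ∀ j ∉ B, Even #{b ∈ B | b < j})
    (hlt : signFlips ((List.finRange n).map fun j => if j ∈ B then 0 else v j) + #B < p) :
    v = 0 := by
  obtain ⟨p, rfl⟩ := Nat.exists_eq_add_one_of_ne_zero hlt.ne_bot
  by_cases hne : ∃ j, (if j ∈ B then 0 else v j) ≠ 0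
  swap
  · push Not at hne
    exact hA.eq_zero_of_support hpn hv (S := B) (by lia) fun j hj => by simpa [hj] using hne j
  obtain ⟨ε, T, m, hε, hT, -, -, -, hpos, -, hall, -⟩ :=
    exists_sign_blocks _ (List.finRange n) (List.pairwise_lt_finRange n)
      (hne.imp fun j hj => ⟨List.mem_finRange j, hj⟩)
  have hTB : T ⊆ Bᶜ := fun t ht => by
    rw [mem_compl]
    intro h
    simpa [h] using hpos t ht
  obtain ⟨S, hTS, hSB, hS, htop⟩ := exists_extension_from_top hTB (c := p - #B)
    (by rw [hT]; lia) (by rw [card_compl, Fintype.card_fin]; lia)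
  have hdisj : Disjoint S B := disjoint_left.2 fun j hj => mem_compl.1 (hSB hj)
  have hSB' : #(S ∪ B) = p := by rw [card_union_of_disjoint hdisj]; lia
  set x : Fin n → ℝ := fun j =>
    (A.submatrix (Fin.cons j ((S ∪ B).orderEmbOfFin hSB')) id).det with hx
  have hx0 : ∀ j ∈ S ∪ B, x j = 0 := by
    intro j hj
    obtain ⟨a, ha⟩ : j ∈ Set.range ((S ∪ B).orderEmbOfFin hSB') := by
      rw [range_orderEmbOfFin]; exact hj
    refine Matrix.det_zero_of_row_eq (i := 0) (j := a.succ) (Fin.succ_ne_zero a).symm ?_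
    ext c
    simp [ha]
  have hsum : ∑ j, v j * x j = 0 := by
    have hlin : ∀ j, x j = ∑ c, A j c * ((-1) ^ (c : ℕ) *
        (A.submatrix ((S ∪ B).orderEmbOfFin hSB') c.succAbove).det) := by
      intro j
      rw [hx]
      dsimp only
      rw [Matrix.det_succ_row_zero]
      refine sum_congr rfl fun c _ => ?_
      simp only [Matrix.submatrix_apply, Fin.cons_zero, id, Matrix.submatrix_submatrix]
      rw [show (Fin.cons j ((S ∪ B).orderEmbOfFin hSB') : Fin (p + 1) → Fin n) ∘ Fin.succ =
        (S ∪ B).orderEmbOfFin hSB' from by ext; simp]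
      simp only [Function.comp_def, id]
      ring
    simp only [hlin, mul_sum]
    rw [sum_comm]
    refine sum_eq_zero fun c _ => ?_
    simp only [← mul_assoc, ← sum_mul]
    have h := congrFun hv c
    simp only [Matrix.vecMul, dotProduct, Pi.zero_apply] at h
    simp [h]
  have hxs : ∀ j ∉ S ∪ B, 0 < (-1) ^ #{s ∈ T | s < j} * x j := by
    intro j hj
    have h := hA.neg_one_pow_mul_det_pos hSB' hj
    rw [mem_union, not_or] at hj
    rw [filter_union, card_union_of_disjoint (disjoint_filter_filter hdisj),
      pow_add, (hB j hj.2).neg_one_pow, mul_one] at h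
    have : {s ∈ S | s < j} = {s ∈ T | s < j} := by
      ext s
      simp only [mem_filter]
      refine ⟨fun ⟨hs, hlt⟩ => ⟨?_, hlt⟩, fun ⟨hs, hlt⟩ => ⟨hTS hs, hlt⟩⟩
      by_contra hsT
      exact hlt.not_gt (htop s hs hsT j (mem_compl.2 hj.2) hj.1)
    rwa [this] at h
  have hnonneg : ∀ j, 0 ≤ ε * (v j * x j) := by
    intro j
    by_cases hj : j ∈ S ∪ B
    · simp [hx0 j hj]
    · have h1 := hall j (List.mem_finRange j)
      rw [if_neg fun h => hj (mem_union_right _ h)] at h1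
      refine (mul_nonneg h1 (hxs j hj).le).trans_eq ?_
      linear_combination ε * v j * x j * (Even.neg_one_pow (α := ℝ) (even_two_mul #{s ∈ T | s < j}))
  have hzero : ∀ j, ε * (v j * x j) = 0 := fun j =>
    (sum_eq_zero_iff_of_nonneg fun j _ => hnonneg j).1
      (by rw [← mul_sum, hsum, mul_zero]) j (mem_univ j)
  refine hA.eq_zero_of_support hpn hv (S := S ∪ B) (by lia) fun j hj => ?_
  have hxj : x j ≠ 0 := right_ne_zero_of_mul (hxs j hj).ne'
  simpa [hε, hxj] using hzero j

/-- Positivity of the maximal minors passes to the transpose. -/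
lemma PosRowMinors.transpose {k n : ℕ} {C : Matrix (Fin k) (Fin n) ℝ} (hC : PosRowMinors C) :
    PosMaximalMinors C.transpose := fun f hf =>
  (hC f hf).trans_eq (Matrix.det_transpose _).symm

open Finset in
/-- A union of disjoint pairs of neighbours has evenly many elements below any other point. -/
lemma ConsecPairs.even_card_filter_lt {r n : ℕ} {B : Fin (2 * r) → Fin n} (hB : StrictMono B)
    (hpair : ConsecPairs B) {j : Fin n} (hj : j ∉ univ.image B) :
    Even #{b ∈ univ.image B | b < j} := by
  rw [filter_image, card_image_of_injective _ hB.injective, card_filter]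
  have key : ∀ s (hs : s ≤ r),
      Even (∑ i : Fin (2 * s), if B (Fin.castLE (by lia) i) < j then 1 else 0) := by
    intro s
    induction s with
    | zero => simp
    | succ s ih =>
      intro hs
      have hsum := ih (by lia)
      change Even (∑ i : Fin (2 * s + 1 + 1), if B (Fin.castLE _ i) < j then 1 else 0)
      rw [Fin.sum_univ_castSucc, Fin.sum_univ_castSucc, add_assoc]
      refine hsum.add ?_
      set a : Fin (2 * r) := ⟨2 * s, by lia⟩
      set b : Fin (2 * r) := ⟨2 * s + 1, by lia⟩
      change Even ((if B a < j then 1 else 0) + if B b < j then 1 else 0)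
      have hab : (B b : ℕ) = B a + 1 := hpair a b rfl (by simp [a])
      have hne : B b ≠ j := fun h => hj (mem_image.2 ⟨b, mem_univ _, h⟩)
      have hiff : B a < j ↔ B b < j := by
        rw [Fin.lt_def, Fin.lt_def]
        rw [Ne, Fin.ext_iff] at hne
        lia
      by_cases h : B b < j <;> simp [hiff, h]
  simpa using key r le_rfl

open Finset in
/-- Adjoining to a set its largest missing point keeps it evenly placed. -/
lemma exists_insert_even {n : ℕ} {B : Finset (Fin n)} (hB : ∀ j ∉ B, Even #{b ∈ B | b < j})
    (hBn : #B < n) : ∃ i ∉ B, ∀ j ∉ insert i B, Even #{b ∈ insert i B | b < j} := by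
  have hne : Bᶜ.Nonempty := by
    rw [← card_pos, card_compl, Fintype.card_fin]; lia
  refine ⟨Bᶜ.max' hne, mem_compl.1 (Bᶜ.max'_mem hne), fun j hj => ?_⟩
  rw [mem_insert, not_or] at hj
  rw [filter_insert, if_neg (Bᶜ.le_max' j (mem_compl.2 hj.2)).not_gt]
  exact hB j hj.2

/-- The twistor coordinate as a linear form in the last row. -/
noncomputable def twistorForm {k r n : ℕ} (Z : Matrix (Fin n) (Fin (k + (r + 1))) ℝ)
    (Y : Matrix (Fin k) (Fin (k + (r + 1))) ℝ) (B : Fin r → Fin n) :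
    (Fin (k + (r + 1)) → ℝ) →ₗ[ℝ] ℝ :=
  (Matrix.detRowAlternating.toMultilinearMap.toLinearMap
    (fun i j => Sum.elim (fun a => Y a)
      (Fin.snoc (α := fun _ => Fin (k + (r + 1)) → ℝ) (fun b => Z (B b)) 0) i (finSumFinEquiv j))
    (Sum.inr (Fin.last r))).comp (LinearMap.funLeft ℝ ℝ finSumFinEquiv)

lemma twistorForm_apply {k r n : ℕ} (Z : Matrix (Fin n) (Fin (k + (r + 1))) ℝ)
    (Y : Matrix (Fin k) (Fin (k + (r + 1))) ℝ) (B : Fin r → Fin n)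
    (z : Fin (k + (r + 1)) → ℝ) :
    twistorForm Z Y B z = Matrix.det (Matrix.of fun i j : Fin k ⊕ Fin (r + 1) =>
      Sum.elim (fun a => Y a) (Fin.snoc (α := fun _ => Fin (k + (r + 1)) → ℝ)
        (fun b => Z (B b)) z) i (finSumFinEquiv j)) := by
  simp only [twistorForm, LinearMap.comp_apply, MultilinearMap.toLinearMap_apply]
  change Matrix.det _ = _
  congr 1
  ext i j
  rcases i with a | b
  · simp [Function.update]
  · induction b using Fin.lastCases with
    | last => simp [LinearMap.funLeft_apply]
    | cast b => simp [Function.update, Fin.castSucc_ne_last]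

lemma twistor_snoc {k r n : ℕ} (Z : Matrix (Fin n) (Fin (k + (r + 1))) ℝ)
    (Y : Matrix (Fin k) (Fin (k + (r + 1))) ℝ) (B : Fin r → Fin n) (i : Fin n) :
    twistor Z Y (Fin.snoc B i : Fin (r + 1) → Fin n) = twistorForm Z Y B (Z i) := by
  rw [twistorForm_apply, twistor]
  congr 1
  ext s j
  rcases s with a | b
  · rfl
  · induction b using Fin.lastCases <;> simp

lemma twistorForm_row {k r n : ℕ} (Z : Matrix (Fin n) (Fin (k + (r + 1))) ℝ)
    (Y : Matrix (Fin k) (Fin (k + (r + 1))) ℝ) (B : Fin r → Fin n) (a : Fin k) :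
    twistorForm Z Y B (Y a) = 0 := by
  rw [twistorForm_apply]
  refine Matrix.det_zero_of_row_eq (i := Sum.inl a) (j := Sum.inr (Fin.last r)) (by simp) ?_
  ext j
  simp

lemma twistorForm_base {k r n : ℕ} (Z : Matrix (Fin n) (Fin (k + (r + 1))) ℝ)
    (Y : Matrix (Fin k) (Fin (k + (r + 1))) ℝ) (B : Fin r → Fin n) (b : Fin r) :
    twistorForm Z Y B (Z (B b)) = 0 := by
  rw [twistorForm_apply]
  refine Matrix.det_zero_of_row_eq (i := Sum.inr b.castSucc) (j := Sum.inr (Fin.last r))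
    (by simp [Fin.castSucc_ne_last]) ?_
  ext j
  simp

open Finset in
/-- A twistor coordinate with evenly placed indices does not vanish. -/
lemma twistor_ne_zero {k m n : ℕ} (hmn : k + m ≤ n) {Z : Matrix (Fin n) (Fin (k + m)) ℝ}
    (hZ : PosMaximalMinors Z) {C : Matrix (Fin k) (Fin n) ℝ} (hC : PosRowMinors C)
    {L : Fin m → Fin n} (hL : Function.Injective L)
    (heven : ∀ j ∉ univ.image L, Even #{b ∈ univ.image L | b < j}) :
    twistor Z (C * Z) L ≠ 0 := by
  intro hdet
  obtain ⟨c, hc0, hc⟩ := Matrix.exists_vecMul_eq_zero_iff.2 hdet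
  apply hc0
  set x : Fin n → ℝ := fun j => ∑ a, c (Sum.inl a) * C a j with hx
  set d : Fin n → ℝ := fun j => ∑ b, if L b = j then c (Sum.inr b) else 0 with hd
  have hdoff : ∀ j ∉ univ.image L, d j = 0 := fun j hj =>
    sum_eq_zero fun b _ => if_neg fun h => hj (mem_image.2 ⟨b, mem_univ b, h⟩)
  have hker : Matrix.vecMul (x + d) Z = 0 := by
    ext e
    have h := congrFun hc (finSumFinEquiv.symm e)
    simp only [Matrix.vecMul, dotProduct, Fintype.sum_sum_type, Matrix.of_apply, Sum.elim_inl,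
      Sum.elim_inr, Equiv.apply_symm_apply, Matrix.mul_apply, Pi.zero_apply] at h
    simp only [Matrix.vecMul, dotProduct, Pi.add_apply, add_mul, sum_add_distrib, Pi.zero_apply]
    rw [← h]
    congr 1
    · simp only [hx, sum_mul, mul_sum, mul_assoc]
      exact sum_comm
    · simp only [hd, sum_mul, ite_mul, zero_mul]
      rw [sum_comm]
      simp
  have hcardL : #(univ.image L) = m := by simp [card_image_of_injective _ hL]
  have hoff : (fun j => if j ∈ univ.image L then 0 else (x + d) j) =
      fun j => if j ∈ univ.image L then 0 else x j := by
    ext j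
    split_ifs with hj
    · rfl
    · simp [hdoff j hj]
  let φ : (Fin k → ℝ) →ₗ[ℝ] ℝ := dotProductBilin ℝ ℝ (fun a => c (Sum.inl a))
  have hv : x + d = 0 := by
    by_cases hne : ∃ j, (if j ∈ univ.image L then 0 else x j) ≠ 0
    · have h := hC.transpose.signFlips_add_card_lt φ (B := ∅) (by simp) (by simp) (by simp)
        (f := fun j => if j ∈ univ.image L then 0 else x j)
        (fun j hj => by
          have : j ∉ univ.image L := fun h => hj (if_pos h)
          simp only [this, if_false]; rfl) hne
      rw [card_empty, add_zero] at h
      refine hZ.eq_zero_of_signFlips_lt hmn hker heven ?_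
      rw [hoff, hcardL]
      lia
    · push Not at hne
      refine hZ.eq_zero_of_support hmn hker (S := univ.image L) (by lia) fun j hj => ?_
      have := hne j
      rw [if_neg hj] at this
      simp [this, hdoff j hj]
  have hxoff : ∀ j ∉ univ.image L, x j = 0 := fun j hj => by
    simpa [hdoff j hj] using congrFun hv j
  have hcl : (fun a => c (Sum.inl a)) = 0 := by
    obtain ⟨R, hRL, hR⟩ := exists_subset_card_eq (s := (univ.image L)ᶜ) (n := k)
      (by rw [card_compl, hcardL, Fintype.card_fin]; lia)
    refine Matrix.eq_zero_of_mulVec_eq_zero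
      (hC.transpose.det_ne_zero (R.orderEmbOfFin hR).injective) ?_
    ext a
    have := hxoff _ (mem_compl.1 (hRL (orderEmbOfFin_mem R hR a)))
    simpa [Matrix.mulVec, dotProduct, hx, mul_comm] using this
  ext s
  rcases s with a | b
  · exact congrFun hcl a
  · have hx0 : x (L b) = 0 := sum_eq_zero fun a _ => by
      rw [show c (Sum.inl a) = 0 from congrFun hcl a, zero_mul]
    simpa [hx0, hd, hL.eq_iff] using congrFun hv (L b)

/-- For `m = 2r+1` odd, `Z` and `C` with positive maximal minors, `Y = C Z`, and `B` a pair
list of length `2r` (paper's `m − 1`), the sequence `(⟨Y, B, i⟩)_{i ∈ [n]}` changes sign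
exactly `k` times (ignoring zeros). -/
theorem stmt11 (k r n : ℕ) (hmn : k + (2 * r + 1) ≤ n)
    (Z : Matrix (Fin n) (Fin (k + (2 * r + 1))) ℝ) (hZ : PosMaximalMinors Z)
    (C : Matrix (Fin k) (Fin n) ℝ) (hC : PosRowMinors C)
    (B : Fin (2 * r) → Fin n) (hB : StrictMono B) (hpair : ConsecPairs B) :
    signFlips ((List.finRange n).map fun i => twistor Z (C * Z) (Fin.snoc B i)) = k := by
  classical
  have heven : ∀ j ∉ Finset.univ.image B, Even (Finset.card {b ∈ Finset.univ.image B | b < j}) :=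
    fun j hj => hpair.even_card_filter_lt hB hj
  have hcard : (Finset.univ.image B).card = 2 * r := by
    simp [Finset.card_image_of_injective _ hB.injective]
  have hu : ∀ i, twistor Z (C * Z) (Fin.snoc B i : Fin (2 * r + 1) → Fin n) =
      twistorForm Z (C * Z) B (Z i) := twistor_snoc Z (C * Z) B
  obtain ⟨i, hi, hieven⟩ := exists_insert_even heven (by lia)
  have himage : Finset.univ.image (Fin.snoc B i : Fin (2 * r + 1) → Fin n) =
      insert i (Finset.univ.image B) := by
    ext j
    simp [Fin.exists_iff_castSucc, eq_comm]
  have hne : twistor Z (C * Z) (Fin.snoc B i : Fin (2 * r + 1) → Fin n) ≠ 0 :=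
    twistor_ne_zero hmn hZ hC (Fin.snoc_injective_iff.2 ⟨hB.injective, by simpa using hi⟩)
      (by rwa [himage])
  refine le_antisymm ?_ ?_
  · have h := hZ.signFlips_add_card_lt (twistorForm Z (C * Z) B) heven
      (by simp [twistorForm_base]) (by lia)
      (f := fun i => twistor Z (C * Z) (Fin.snoc B i)) (fun j _ => hu j) ⟨i, hne⟩
    lia
  · by_contra! hlt
    have hker : Matrix.vecMul
        (fun i => twistor Z (C * Z) (Fin.snoc B i : Fin (2 * r + 1) → Fin n)) C.transpose = 0 := by
      ext a
      have hrow : (C * Z) a = ∑ i, C a i • Z i := by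
        ext e
        simp [Matrix.mul_apply]
      have h := twistorForm_row Z (C * Z) B a
      rw [hrow] at h
      simpa [Matrix.vecMul, dotProduct, hu, mul_comm] using h
    have h := hC.transpose.eq_zero_of_signFlips_lt (by lia) hker (B := ∅) (by simp)
      (by simpa using hlt)
    exact hne (congrFun h i)
end

section
/- Let m = 2r−1 be odd, k, n with k+m ≤ n, Z an n×(k+m) matrix with positive maximal minors, C a k×n matrix with positive maximal minors, Y = CZ, and B = (b_1, b_1+1, ..., b_{r−1}, b_{r−1}+1) ⊂ [n]. Then the sequence (⟨Y, B, i⟩) for i ranging over [n]∖B (in increasing order) cannot contain two consecutive zeros. -/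
open Matrix

/-- The sign attached to an ordered pair: `1` if it is increasing and `-1` otherwise. -/
noncomputable def pairSign {n : ℕ} (x y : Fin n) : ℝ := if x < y then 1 else -1

/-- The parity of the number of inversions of a sequence. -/
noncomputable def inversionSign {p n : ℕ} (h : Fin p → Fin n) : ℝ :=
  ∏ j, ∏ i ∈ Finset.Iio j, pairSign (h i) (h j)

lemma pairSign_mul_self {n : ℕ} (x y : Fin n) : pairSign x y * pairSign x y = 1 := by
  unfold pairSign; split_ifs <;> norm_num

lemma inversionSign_mul_self {p n : ℕ} (h : Fin p → Fin n) :
    inversionSign h * inversionSign h = 1 := by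
  simp [inversionSign, ← Finset.prod_mul_distrib, pairSign_mul_self]

lemma StrictMono.inversionSign_eq_one {p n : ℕ} {h : Fin p → Fin n} (hh : StrictMono h) :
    inversionSign h = 1 := by
  refine Finset.prod_eq_one fun j _ => Finset.prod_eq_one fun i hi => ?_
  exact if_pos (hh (Finset.mem_Iio.1 hi))

lemma inversionSign_snoc {p n : ℕ} (h : Fin p → Fin n) (x : Fin n) :
    inversionSign (Fin.snoc h x : Fin (p + 1) → Fin n) =
      inversionSign h * ∏ a, pairSign (h a) x := by
  have hlast : Finset.Iio (Fin.last p) = Finset.univ.map Fin.castSuccEmb := by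
    ext y
    simp [Fin.exists_castSucc_eq]
  simp only [inversionSign, Fin.prod_univ_castSucc, Fin.Iio_castSucc, hlast, Finset.prod_map,
    Fin.coe_castSuccEmb, Fin.snoc_castSucc, Fin.snoc_last]

lemma inversionSign_append {k t n : ℕ} (g : Fin k → Fin n) (L : Fin t → Fin n) :
    inversionSign (Fin.append g L) =
      inversionSign g * inversionSign L * ∏ a, ∏ b, pairSign (g a) (L b) := by
  induction t with
  | zero =>
    have : inversionSign L = 1 := by simp [inversionSign]
    rw [this]
    simp only [Finset.univ_eq_empty, Finset.prod_empty, Finset.prod_const_one, mul_one]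
    rw [Fin.append_right_nil g L rfl]
    rfl
  | succ t ih =>
    obtain ⟨L', x, rfl⟩ : ∃ (L' : Fin t → Fin n) (x : Fin n), L = Fin.snoc L' x :=
      ⟨Fin.init L, L (Fin.last t), (Fin.snoc_init_self L).symm⟩
    have h := inversionSign_snoc (Fin.append g L') x
    rw [ih, Fin.prod_univ_add] at h
    rw [Fin.append_snoc]
    refine h.trans ?_
    rw [inversionSign_snoc]
    simp only [Fin.append_left, Fin.append_right, Fin.prod_univ_castSucc, Fin.snoc_castSucc,
      Fin.snoc_last, Finset.prod_mul_distrib]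
    ring

/-- An injective tuple differs from an increasing one by a permutation whose sign is the parity
of the number of inversions. -/
lemma exists_strictMono_comp_perm {p n : ℕ} {h : Fin p → Fin n} (hh : Function.Injective h) :
    ∃ (f : Fin p → Fin n) (σ : Equiv.Perm (Fin p)), StrictMono f ∧ h = f ∘ σ ∧
      ((Equiv.Perm.sign σ : ℤ) : ℝ) = inversionSign h := by
  have hmono : StrictMono (h ∘ Tuple.sort h) :=
    (Tuple.monotone_sort h).strictMono_of_injective (hh.comp (Tuple.sort h).injective)
  have hcomp : h = (h ∘ Tuple.sort h) ∘ (Tuple.sort h).symm := by ext; simp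
  refine ⟨h ∘ Tuple.sort h, (Tuple.sort h).symm, hmono, hcomp, ?_⟩
  rw [Equiv.Perm.sign_eq_prod_prod_Iio]
  push_cast
  refine Finset.prod_congr rfl fun j _ => Finset.prod_congr rfl fun i _ => ?_
  have : h i < h j ↔ (Tuple.sort h).symm i < (Tuple.sort h).symm j := by
    rw [← hmono.lt_iff_lt]; simp
  unfold pairSign
  simp only [this]
  split_ifs <;> simp

lemma PosMaximalMinors.inversionSign_mul_det_pos {n p : ℕ} {Z : Matrix (Fin n) (Fin p) ℝ}
    (hZ : PosMaximalMinors Z) {h : Fin p → Fin n} (hh : Function.Injective h) :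
    0 < inversionSign h * (Z.submatrix h id).det := by
  obtain ⟨f, σ, hf, hfσ, hσ⟩ := exists_strictMono_comp_perm hh
  have hdet : (Z.submatrix h id).det = inversionSign h * (Z.submatrix f id).det := by
    rw [← hσ, ← det_permute, submatrix_submatrix, hfσ]; rfl
  rw [hdet, ← mul_assoc, inversionSign_mul_self, one_mul]
  exact hZ f hf

lemma PosRowMinors.posMaximalMinors_transpose {k n : ℕ} {C : Matrix (Fin k) (Fin n) ℝ}
    (hC : PosRowMinors C) : PosMaximalMinors Cᵀ := by
  intro f hf
  rw [← det_transpose]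
  exact hC f hf

lemma PosRowMinors.inversionSign_mul_det_pos {k n : ℕ} {C : Matrix (Fin k) (Fin n) ℝ}
    (hC : PosRowMinors C) {h : Fin k → Fin n} (hh : Function.Injective h) :
    0 < inversionSign h * (C.submatrix id h).det := by
  rw [← det_transpose, transpose_submatrix]
  exact hC.posMaximalMinors_transpose.inversionSign_mul_det_pos hh

/-- Expansion of a determinant whose first rows are rows of a product `A * Z`. -/
lemma sum_prod_mul_det_append {k t n : ℕ} (A : Matrix (Fin k) (Fin n) ℝ)
    (Z : Matrix (Fin n) (Fin (k + t)) ℝ) (L : Fin t → Fin n) :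
    ∑ g : Fin k → Fin n, (∏ a, A a (g a)) * (Z.submatrix (Fin.append g L) id).det =
      (Matrix.of (Fin.append (fun a => (A * Z) a) fun b => Z (L b))).det := by
  let F : MultilinearMap ℝ (fun _ : Fin k ⊕ Fin t => Fin (k + t) → ℝ) ℝ :=
    ((detRowAlternating (R := ℝ) (n := Fin (k + t))).toMultilinearMap).domDomCongr
      finSumFinEquiv.symm
  have hF : ∀ (v : Fin k → Fin (k + t) → ℝ) (w : Fin t → Fin (k + t) → ℝ),
      F.currySum v w = (Matrix.of (Fin.append v w)).det := by
    intro v w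
    change Matrix.det _ = _
    congr 1
    ext x y
    refine Fin.addCases (fun a => ?_) (fun b => ?_) x <;> simp
  have hrow : (fun a => (A * Z) a) = fun a => ∑ j, A a j • Z j := by
    ext a y
    simp [Matrix.mul_apply]
  rw [← hF, hrow, MultilinearMap.map_sum, _root_.sum_apply]
  refine Finset.sum_congr rfl fun g _ => ?_
  rw [MultilinearMap.map_smul_univ, _root_.smul_apply, hF, smul_eq_mul]
  congr 2
  ext x y
  refine Fin.addCases (fun a => ?_) (fun b => ?_) x <;> simp

/-- If the rows of `C * Z` and the rows of `Z` indexed by `L` lie in a common hyperplane, then the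
Cauchy–Binet type sum of products of minors through `T` and `L` vanishes. -/
lemma sum_det_mul_det_eq_zero {k s t n : ℕ} (C : Matrix (Fin (k + s)) (Fin n) ℝ)
    (Z : Matrix (Fin n) (Fin (k + t)) ℝ) (T : Fin s → Fin n) (L : Fin t → Fin n)
    {u : Fin (k + t) → ℝ} (hu : u ≠ 0) (hY : (C * Z) *ᵥ u = 0) (hL : ∀ b, Z (L b) ⬝ᵥ u = 0) :
    ∑ g : Fin k → Fin n, (C.submatrix id (Fin.append g T)).det *
      (Z.submatrix (Fin.append g L) id).det = 0 := by
  simp only [det_apply' (C.submatrix _ _), Finset.sum_mul]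
  rw [Finset.sum_comm]
  refine Finset.sum_eq_zero fun σ _ => ?_
  let A : Matrix (Fin k) (Fin n) ℝ := C.submatrix (fun a => σ (Fin.castAdd s a)) id
  have hdet : (Matrix.of (Fin.append (fun a => (A * Z) a) fun b => Z (L b))).det = 0 := by
    refine exists_mulVec_eq_zero_iff.1 ⟨u, hu, ?_⟩
    ext x
    refine Fin.addCases (fun a => ?_) (fun b => ?_) x
    · simpa [mulVec, A, Matrix.mul_apply, dotProduct] using
        congrFun hY (σ (Fin.castAdd s a))
    · simpa [mulVec] using hL b
  rw [← sum_prod_mul_det_append] at hdet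
  calc _ = (((Equiv.Perm.sign σ : ℤ) : ℝ) * ∏ c, C (σ (Fin.natAdd k c)) (T c)) *
        ∑ g : Fin k → Fin n, (∏ a, A a (g a)) * (Z.submatrix (Fin.append g L) id).det := by
        rw [Finset.mul_sum]
        refine Finset.sum_congr rfl fun g _ => ?_
        simp only [Fin.prod_univ_add, submatrix_apply, id, Fin.append_left, Fin.append_right, A]
        ring
    _ = 0 := by rw [hdet, mul_zero]

lemma exists_strictMono_notMem {k n : ℕ} {S : Finset (Fin n)} (hS : k + S.card ≤ n) :
    ∃ g : Fin k → Fin n, StrictMono g ∧ ∀ a, g a ∉ S := by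
  have hk : k ≤ Sᶜ.card := by
    rw [Finset.card_compl, Fintype.card_fin]
    omega
  exact ⟨Sᶜ.orderEmbOfCardLe hk, (Sᶜ.orderEmbOfCardLe hk).strictMono,
    fun a => Finset.mem_compl.1 (Finset.orderEmbOfCardLe_mem Sᶜ hk a)⟩

/-- A parity condition on `T` and `L` under which all products of minors through `T` and `L` are
nonnegative, so that no hyperplane contains the rows of `C * Z` and the rows of `Z` indexed
by `L`. -/
lemma eq_zero_of_inversionSign_eq_one {k s t n c p : ℕ} (hc : c = k + s) (hp : p = k + t)
    (hn : k + (s + t) ≤ n) {C : Matrix (Fin c) (Fin n) ℝ} (hC : PosRowMinors C)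
    {Z : Matrix (Fin n) (Fin p) ℝ} (hZ : PosMaximalMinors Z)
    {T : Fin s → Fin n} {L : Fin t → Fin n}
    (hT : Function.Injective T) (hL : Function.Injective L)
    (hTsign : inversionSign T = 1) (hLsign : inversionSign L = 1)
    (hcross : ∀ x, (∀ b, x ≠ T b) → (∀ b, x ≠ L b) →
      (∏ b, pairSign x (T b)) * ∏ b, pairSign x (L b) = 1)
    {u : Fin p → ℝ} (hYu : (C * Z) *ᵥ u = 0) (hLu : ∀ b, Z (L b) ⬝ᵥ u = 0) : u = 0 := by
  subst hc hp
  by_contra hu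
  have hzero := sum_det_mul_det_eq_zero C Z T L hu hYu hLu
  have hpos : ∀ g : Fin k → Fin n, Function.Injective (Fin.append g T) →
      Function.Injective (Fin.append g L) → 0 < (C.submatrix id (Fin.append g T)).det *
      (Z.submatrix (Fin.append g L) id).det := by
    intro g hgT hgL
    have hsign : inversionSign (Fin.append g T) * inversionSign (Fin.append g L) = 1 := by
      rw [inversionSign_append, inversionSign_append, hTsign, hLsign, mul_one, mul_mul_mul_comm,
        inversionSign_mul_self, one_mul, ← Finset.prod_mul_distrib]
      exact Finset.prod_eq_one fun a _ => hcross _ ((Fin.append_injective_iff.1 hgT).2.2 a)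
        ((Fin.append_injective_iff.1 hgL).2.2 a)
    have := mul_pos (hC.inversionSign_mul_det_pos hgT) (hZ.inversionSign_mul_det_pos hgL)
    rwa [mul_mul_mul_comm, hsign, one_mul] at this
  obtain ⟨g₀, hg₀, hg₀'⟩ : ∃ g : Fin k → Fin n, StrictMono g ∧
      ∀ a, g a ∉ Finset.univ.image T ∪ Finset.univ.image L := by
    refine exists_strictMono_notMem (le_trans (Nat.add_le_add_left ?_ k) hn)
    refine (Finset.card_union_le _ _).trans (Nat.add_le_add ?_ ?_) <;>
      exact Finset.card_image_le.trans_eq (Finset.card_fin _)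
  have hgT : Function.Injective (Fin.append g₀ T) :=
    Fin.append_injective_iff.2 ⟨hg₀.injective, hT, fun a b h => hg₀' a (by simp [h])⟩
  have hgL : Function.Injective (Fin.append g₀ L) :=
    Fin.append_injective_iff.2 ⟨hg₀.injective, hL, fun a b h => hg₀' a (by simp [h])⟩
  refine (Finset.sum_pos' (fun g _ => ?_) ⟨g₀, Finset.mem_univ _, hpos g₀ hgT hgL⟩).ne' hzero
  by_cases hT : Function.Injective (Fin.append g T)
  · by_cases hL : Function.Injective (Fin.append g L)
    · exact (hpos g hT hL).le
    · obtain ⟨x, y, hxy, hne⟩ := Function.not_injective_iff.1 hL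
      rw [det_zero_of_row_eq (M := Z.submatrix _ _) hne (by ext z; simp [hxy]), mul_zero]
  · obtain ⟨x, y, hxy, hne⟩ := Function.not_injective_iff.1 hT
    rw [det_zero_of_column_eq (M := C.submatrix _ _) hne (by intro z; simp [hxy]), zero_mul]

/-- When `Z` is square, the rows of `C * Z` and any complementary number of rows of `Z` are
linearly independent. -/
lemma eq_zero_of_square {k t n p : ℕ} (hp : p = k + t) (hn : n = k + t)
    {C : Matrix (Fin k) (Fin n) ℝ} (hC : PosRowMinors C)
    {Z : Matrix (Fin n) (Fin p) ℝ} (hZ : PosMaximalMinors Z)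
    {L : Fin t → Fin n} (hL : Function.Injective L)
    {u : Fin p → ℝ} (hYu : (C * Z) *ᵥ u = 0) (hLu : ∀ b, Z (L b) ⬝ᵥ u = 0) : u = 0 := by
  obtain rfl : n = p := hn.trans hp.symm
  refine eq_zero_of_mulVec_eq_zero (M := Z) (hZ id strictMono_id).ne' ?_
  obtain ⟨g, hg, hgL⟩ : ∃ g : Fin k → Fin n, StrictMono g ∧ ∀ a, g a ∉ Finset.univ.image L :=
    exists_strictMono_notMem (by simp [Finset.card_image_of_injective _ hL, hn])
  have hinj : Function.Injective (Sum.elim g L) :=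
    hg.injective.sumElim hL fun a b h => hgL a (by simp [h])
  have hbij : Function.Bijective (Sum.elim g L) :=
    (Fintype.bijective_iff_injective_and_card _).2 ⟨hinj, by simp [hn]⟩
  have hg0 : (Z *ᵥ u) ∘ g = 0 := by
    refine eq_zero_of_mulVec_eq_zero (M := C.submatrix id g) (hC g hg).ne' ?_
    rw [← mulVec_mulVec] at hYu
    ext a
    have ha := congrFun hYu a
    rw [mulVec, dotProduct, ← hbij.sum_comp, Fintype.sum_sum_type] at ha
    have hzero : ∑ b, C a (L b) * (Z *ᵥ u) (L b) = 0 :=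
      Finset.sum_eq_zero fun b _ => by
        rw [show (Z *ᵥ u) (L b) = 0 from hLu b, mul_zero]
    simp only [Sum.elim_inl, Sum.elim_inr, hzero, add_zero] at ha
    exact ha
  ext x
  obtain ⟨y, rfl⟩ := hbij.surjective x
  cases y with
  | inl a => exact congrFun hg0 a
  | inr b => exact hLu b

lemma prod_eq_one_of_pairs {r : ℕ} {f : Fin (2 * r) → ℝ}
    (hf : ∀ a b : Fin (2 * r), (a : ℕ) + 1 = b → (a : ℕ) % 2 = 0 → f a * f b = 1) :
    ∏ a, f a = 1 := by
  induction r with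
  | zero => simp
  | succ r ih =>
    change ∏ a : Fin (2 * r + 1 + 1), f a = 1
    rw [Fin.prod_univ_castSucc, Fin.prod_univ_castSucc, mul_assoc,
      ih (f := fun a => f a.castSucc.castSucc)
        fun a b h h' => hf _ _ (by simpa using h) (by simpa using h'), one_mul]
    exact hf _ _ (by simp) (by simp)

lemma ConsecPairs.prod_pairSign_left {r n : ℕ} {B : Fin (2 * r) → Fin n} (hB : ConsecPairs B)
    {x : Fin n} (hx : ∀ a, B a ≠ x) : ∏ a, pairSign x (B a) = 1 := by
  refine prod_eq_one_of_pairs fun a b hab ha => ?_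
  have h := hB a b hab ha
  have h₁ := hx a
  have h₂ := hx b
  rw [Ne, Fin.ext_iff] at h₁ h₂
  have : x < B a ↔ x < B b := by rw [Fin.lt_def, Fin.lt_def]; omega
  rw [pairSign, if_congr this rfl rfl]
  exact pairSign_mul_self _ _

lemma ConsecPairs.prod_pairSign_right {r n : ℕ} {B : Fin (2 * r) → Fin n} (hB : ConsecPairs B)
    {x : Fin n} (hx : ∀ a, B a ≠ x) : ∏ a, pairSign (B a) x = 1 := by
  refine prod_eq_one_of_pairs fun a b hab ha => ?_
  have h := hB a b hab ha
  have h₁ := hx a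
  have h₂ := hx b
  rw [Ne, Fin.ext_iff] at h₁ h₂
  have : B a < x ↔ B b < x := by rw [Fin.lt_def, Fin.lt_def]; omega
  rw [pairSign, if_congr this rfl rfl]
  exact pairSign_mul_self _ _

lemma injective_snoc {p n : ℕ} {h : Fin p → Fin n} (hh : Function.Injective h) {x : Fin n}
    (hx : ∀ a, h a ≠ x) : Function.Injective (Fin.snoc h x : Fin (p + 1) → Fin n) := by
  intro a b
  refine Fin.lastCases ?_ (fun a => ?_) a <;> refine Fin.lastCases ?_ (fun b => ?_) b
  · simp
  · simpa using fun hb => absurd hb.symm (hx b)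
  · simpa using fun ha => absurd ha (hx a)
  · simpa using fun hab => hh hab

lemma prod_pairSign_snoc {p n : ℕ} (h : Fin p → Fin n) (x y : Fin n) :
    ∏ b, pairSign y ((Fin.snoc h x : Fin (p + 1) → Fin n) b) =
      (∏ b, pairSign y (h b)) * pairSign y x := by
  simp [Fin.prod_univ_castSucc]

lemma exists_mulVec_eq_zero_of_twistor_eq_zero {k m n : ℕ} {Z : Matrix (Fin n) (Fin (k + m)) ℝ}
    {Y : Matrix (Fin k) (Fin (k + m)) ℝ} {L : Fin m → Fin n} (h : twistor Z Y L = 0) :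
    ∃ u : Fin (k + m) → ℝ, u ≠ 0 ∧ Y *ᵥ u = 0 ∧ ∀ b, Z (L b) ⬝ᵥ u = 0 := by
  obtain ⟨v, hv, hMv⟩ := exists_mulVec_eq_zero_iff.2 h
  have hsum : ∀ w : Fin (k + m) → ℝ, w ⬝ᵥ (v ∘ finSumFinEquiv.symm) =
      (w ∘ finSumFinEquiv) ⬝ᵥ v := by
    intro w
    rw [← comp_equiv_symm_dotProduct, Equiv.symm_symm]
  refine ⟨v ∘ finSumFinEquiv.symm, fun h0 => hv ?_, ?_, fun b => ?_⟩
  · ext x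
    simpa using congrFun h0 (finSumFinEquiv x)
  · ext a
    exact (hsum _).trans (congrFun hMv (Sum.inl a))
  · exact (hsum _).trans (congrFun hMv (Sum.inr b))

/-- If `q` is the last index outside a list `B` of pairs, then `Y`, `B` and `q` are linearly
independent. -/
lemma ConsecPairs.eq_zero_of_last {k r n : ℕ} (hmn : k + (2 * r + 1) ≤ n)
    {Z : Matrix (Fin n) (Fin (k + (2 * r + 1))) ℝ} (hZ : PosMaximalMinors Z)
    {C : Matrix (Fin k) (Fin n) ℝ} (hC : PosRowMinors C)
    {B : Fin (2 * r) → Fin n} (hB : StrictMono B) (hpair : ConsecPairs B)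
    {q : Fin n} (hq : ∀ a, B a ≠ q) (hlast : ∀ x, (∀ a, B a ≠ x) → x ≤ q)
    {u : Fin (k + (2 * r + 1)) → ℝ} (hYu : (C * Z) *ᵥ u = 0) (hBu : ∀ b, Z (B b) ⬝ᵥ u = 0)
    (hqu : Z q ⬝ᵥ u = 0) : u = 0 := by
  refine eq_zero_of_inversionSign_eq_one (s := 0) (T := Fin.elim0) (L := Fin.snoc B q) rfl rfl
    (by omega) hC hZ (Function.injective_of_subsingleton _) (injective_snoc hB.injective hq)
    (Subsingleton.strictMono _).inversionSign_eq_one ?_ (fun x _ hx => ?_) hYu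
    (Fin.lastCases ?_ fun b => ?_)
  · rw [inversionSign_snoc, hB.inversionSign_eq_one, hpair.prod_pairSign_right hq, one_mul]
  · have hxB : ∀ a, B a ≠ x := fun a h => hx a.castSucc (by simp [h])
    have hxq : x ≠ q := by simpa using hx (Fin.last _)
    rw [prod_pairSign_snoc, hpair.prod_pairSign_left hxB, pairSign,
      if_pos ((hlast x hxB).lt_of_ne hxq)]
    simp
  · simpa using hqu
  · simpa using hBu b

/-- The rows of `C * Z` together with those of `Z` indexed by `B` and two consecutive indices
outside `B` do not lie in a common hyperplane. -/
lemma ConsecPairs.eq_zero_of_consecutive {k r n : ℕ} (hmn : k + (2 * r + 1) < n)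
    {Z : Matrix (Fin n) (Fin (k + (2 * r + 1))) ℝ} (hZ : PosMaximalMinors Z)
    {C : Matrix (Fin k) (Fin n) ℝ} (hC : PosRowMinors C) (hk : k ≠ 0)
    {B : Fin (2 * r) → Fin n} (hB : StrictMono B) (hpair : ConsecPairs B)
    {i i' : Fin n} (hlt : i < i') (hiB : ∀ a, B a ≠ i) (hi'B : ∀ a, B a ≠ i')
    (hbetw : ∀ j : Fin n, i < j → j < i' → ∃ a, B a = j)
    {q : Fin n} (hlast : ∀ x, (∀ a, B a ≠ x) → x ≤ q)
    {u : Fin (k + (2 * r + 1)) → ℝ} (hYu : (C * Z) *ᵥ u = 0) (hBu : ∀ b, Z (B b) ⬝ᵥ u = 0)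
    (hiu : Z i ⬝ᵥ u = 0) (hi'u : Z i' ⬝ᵥ u = 0) : u = 0 := by
  obtain ⟨l, rfl⟩ := Nat.exists_eq_succ_of_ne_zero hk
  have hi' : ∀ a, (Fin.snoc B i : Fin (2 * r + 1) → Fin n) a ≠ i' :=
    Fin.lastCases (by simpa using hlt.ne) fun a => by simpa using hi'B a
  refine eq_zero_of_inversionSign_eq_one (k := l) (s := 1) (T := fun _ => q)
    (L := Fin.snoc (Fin.snoc B i : Fin (2 * r + 1) → Fin n) i') rfl (by omega)
    (by omega) hC hZ (Function.injective_of_subsingleton _)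
    (injective_snoc (injective_snoc hB.injective hiB) hi')
    (Subsingleton.strictMono _).inversionSign_eq_one ?_ (fun x hxq hx => ?_) hYu
    (Fin.lastCases ?_ (Fin.lastCases ?_ fun b => ?_))
  · rw [inversionSign_snoc, inversionSign_snoc, hB.inversionSign_eq_one,
      hpair.prod_pairSign_right hiB, Fin.prod_univ_castSucc]
    simp only [Fin.snoc_castSucc, Fin.snoc_last]
    rw [hpair.prod_pairSign_right hi'B, pairSign, if_pos hlt]
    simp
  · have hxB : ∀ a, B a ≠ x := fun a h => hx a.castSucc.castSucc (by simp [h])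
    have hxi : x ≠ i := by simpa using hx (Fin.last _).castSucc
    have hxi' : x ≠ i' := by simpa using hx (Fin.last _)
    have hside : x < i ↔ x < i' := by
      refine ⟨fun h => h.trans hlt, fun h => ?_⟩
      by_contra hxlt
      obtain ⟨a, ha⟩ := hbetw x ((not_lt.1 hxlt).lt_of_ne hxi.symm) h
      exact hxB a ha
    have hpairSign : pairSign x i = pairSign x i' := if_congr hside rfl rfl
    rw [prod_pairSign_snoc, prod_pairSign_snoc, hpair.prod_pairSign_left hxB, hpairSign, one_mul,
      pairSign_mul_self, Fin.prod_univ_one, pairSign, if_pos ((hlast x hxB).lt_of_ne (hxq 0)),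
      one_mul]
  · simpa using hi'u
  · simpa using hiu
  · simpa using hBu b

/-- For `m = 2r+1` odd, `Z` and `C` with positive maximal minors, `Y = C Z`, `B` a pair list
of length `2r`: the sequence `(⟨Y, B, i⟩)` over `i ∈ [n] ∖ B` (in increasing order) cannot
contain two consecutive zeros: if `i < i'` are both outside `B` and every index strictly
between them lies in `B`, then `⟨Y,B,i⟩` and `⟨Y,B,i'⟩` are not both zero. -/
theorem stmt12 (k r n : ℕ) (hmn : k + (2 * r + 1) ≤ n)
    (Z : Matrix (Fin n) (Fin (k + (2 * r + 1))) ℝ) (hZ : PosMaximalMinors Z)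
    (C : Matrix (Fin k) (Fin n) ℝ) (hC : PosRowMinors C)
    (B : Fin (2 * r) → Fin n) (hB : StrictMono B) (hpair : ConsecPairs B)
    (i i' : Fin n) (hlt : i < i')
    (hiB : ∀ a, B a ≠ i) (hi'B : ∀ a, B a ≠ i')
    (hbetw : ∀ j : Fin n, i < j → j < i' → ∃ a, B a = j) :
    ¬ (twistor Z (C * Z) (Fin.snoc B i) = 0 ∧ twistor Z (C * Z) (Fin.snoc B i') = 0) := by
  rintro ⟨h, h'⟩
  obtain ⟨u, hu, hYu, hLu⟩ := exists_mulVec_eq_zero_of_twistor_eq_zero h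
  obtain ⟨v, hv, hYv, hLv⟩ := exists_mulVec_eq_zero_of_twistor_eq_zero h'
  have hsquare : n ≠ k + (2 * r + 1) := fun hn =>
    hu (eq_zero_of_square rfl hn hC hZ (injective_snoc hB.injective hiB) hYu hLu)
  have hiu : Z i ⬝ᵥ u = 0 := by simpa using hLu (Fin.last _)
  have hiv : Z i' ⬝ᵥ v = 0 := by simpa using hLv (Fin.last _)
  replace hLu : ∀ b, Z (B b) ⬝ᵥ u = 0 := fun b => by simpa using hLu b.castSucc
  replace hLv : ∀ b, Z (B b) ⬝ᵥ v = 0 := fun b => by simpa using hLv b.castSucc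
  obtain ⟨q, hq, hlast⟩ : ∃ q, (∀ a, B a ≠ q) ∧ ∀ x, (∀ a, B a ≠ x) → x ≤ q := by
    obtain ⟨q, hq, hmax⟩ := (Finset.univ.filter fun x => ∀ a, B a ≠ x).exists_max_image id
      ⟨i, by simpa using hiB⟩
    exact ⟨q, by simpa using hq, fun x hx => hmax x (by simpa using hx)⟩
  have hindep : ∀ w : Fin (k + (2 * r + 1)) → ℝ, (C * Z) *ᵥ w = 0 → (∀ b, Z (B b) ⬝ᵥ w = 0) →
      Z q ⬝ᵥ w = 0 → w = 0 :=
    fun w => hpair.eq_zero_of_last hmn hZ hC hB hq hlast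
  have hqv : Z q ⬝ᵥ v ≠ 0 := fun h0 => hv (hindep v hYv hLv h0)
  have hcomb : (Z q ⬝ᵥ v) • u - (Z q ⬝ᵥ u) • v = 0 := by
    refine hindep _ ?_ (fun b => ?_) ?_
    · rw [mulVec_sub, mulVec_smul, mulVec_smul, hYu, hYv]
      simp
    · rw [dotProduct_sub, dotProduct_smul, dotProduct_smul, hLu, hLv]
      simp
    · rw [dotProduct_sub, dotProduct_smul, dotProduct_smul, smul_eq_mul, smul_eq_mul]
      ring
  have hi'u : Z i' ⬝ᵥ u = 0 := by
    have := congrArg (Z i' ⬝ᵥ ·) hcomb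
    simpa [dotProduct_sub, dotProduct_smul, hiv, hqv] using this
  refine hu (hpair.eq_zero_of_consecutive (lt_of_le_of_ne hmn hsquare.symm) hZ hC ?_ hB hlt hiB
    hi'B hbetw hlast hYu hLu hiu hi'u)
  rintro rfl
  have hinj := (injective_snoc hB.injective hiB).comp
    (Fin.cast_injective (Nat.zero_add (2 * r + 1)))
  refine hu (eq_zero_of_mulVec_eq_zero
    (right_ne_zero_of_mul (hZ.inversionSign_mul_det_pos hinj).ne') (funext fun x => ?_))
  change Z ((Fin.snoc B i : Fin (2 * r + 1) → Fin n) (Fin.cast _ x)) ⬝ᵥ u = 0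
  refine Fin.lastCases ?_ (fun b => ?_) (Fin.cast (Nat.zero_add (2 * r + 1)) x)
  · simpa using hiu
  · simpa using hLu b
end

section
/- Let m = 2r−1 be odd, and let S(i_1, i_1+1, ..., i_r, i_r+1) be a simplex containing the origin of the quotient space V_Y, where Y = CZ with C having positive maximal minors and Z having positive maximal minors. Then the simplex is full-dimensional, i.e., the 2r = m+1 points Z_{i_1}, Z_{i_1+1}, ..., Z_{i_r}, Z_{i_r+1} ∈ V_Y ≅ ℝ^m are affinely independent. Equivalently in twistor coordinates: it is impossible that ⟨Y, L⟩ = 0 for all m-element sublists L of (i_1, i_1+1, ..., i_r, i_r+1). -/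
/-- Cramer's rule: `k + 1` columns of a matrix with positive maximal minors satisfy a linear
relation whose coefficients strictly alternate in sign. -/
lemma PosRowMinors.exists_alternating_relation {k n : ℕ} {C : Matrix (Fin k) (Fin n) ℝ}
    (hC : PosRowMinors C) {q : Fin (k + 1) → Fin n} (hq : StrictMono q) :
    ∃ Δ : Fin (k + 1) → ℝ, (∀ i, 0 < Δ i) ∧
      ∀ a, ∑ i : Fin (k + 1), (-1) ^ (i : ℕ) * Δ i * C a (q i) = 0 := by
  refine ⟨fun i => Matrix.det (Matrix.of fun a b => C a (q (i.succAbove b))),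
    fun i => hC _ (hq.comp (Fin.strictMono_succAbove i)), fun a => ?_⟩
  let N : Matrix (Fin (k + 1)) (Fin (k + 1)) ℝ :=
    Matrix.of (Fin.cons (fun i => C a (q i)) fun b i => C b (q i))
  have hN : N.det = 0 :=
    Matrix.det_zero_of_row_eq (i := 0) (j := a.succ) (Fin.succ_ne_zero a).symm
      (by ext i; simp [N])
  rw [Matrix.det_succ_row_zero] at hN
  rw [← hN]
  refine Finset.sum_congr rfl fun i _ => ?_
  have : N.submatrix Fin.succ i.succAbove
      = Matrix.of fun a b => C a (q (i.succAbove b)) := by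
    ext b j; simp [N]
  rw [this]
  simp only [N, Matrix.of_apply, Fin.cons_zero]
  ring

/-- Any `k` columns of a matrix with positive maximal minors are linearly independent. -/
lemma PosRowMinors.eq_zero_of_card_support_le {k n : ℕ} {C : Matrix (Fin k) (Fin n) ℝ}
    (hC : PosRowMinors C) (hkn : k ≤ n) {w : Fin n → ℝ} (hw : C.mulVec w = 0)
    (hcard : (Finset.univ.filter fun i => w i ≠ 0).card ≤ k) : w = 0 := by
  obtain ⟨S, hS, hSk⟩ := Finset.exists_superset_card_eq hcard (by simpa using hkn)
  have hdet := hC (S.orderEmbOfFin hSk) (S.orderEmbOfFin hSk).strictMono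
  have hoff : ∀ j, j ∉ Set.range (S.orderEmbOfFin hSk) → w j = 0 := by
    intro j hj
    rw [Finset.range_orderEmbOfFin] at hj
    by_contra h
    exact hj (hS (by simpa using h))
  have hzero := Matrix.eq_zero_of_mulVec_eq_zero hdet.ne'
    (v := fun b => w (S.orderEmbOfFin hSk b)) (by
      ext a
      rw [← congrFun hw a]
      exact Fintype.sum_of_injective _ (S.orderEmbOfFin hSk).injective _ _
        (fun j hj => by simp [hoff j hj]) fun b => by simp)
  ext j
  by_cases hj : j ∈ Set.range (S.orderEmbOfFin hSk)
  · obtain ⟨b, rfl⟩ := hj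
    exact congrFun hzero b
  · exact hoff j hj

/-- Subtracting a suitable multiple of `x` from `w` kills a coordinate of `w` without reversing
the sign of any other. -/
lemma exists_sub_smul_conformal {ι : Type*} [Fintype ι] {w x : ι → ℝ}
    (hx : x ≠ 0) : ∃ t : ℝ, (∃ i, x i ≠ 0 ∧ w i - t * x i = 0) ∧
      ∀ i, 0 ≤ w i * (w i - t * x i) := by
  classical
  obtain ⟨i₀, hi₀⟩ := Function.ne_iff.mp hx
  obtain ⟨i, hi, hmin⟩ := (Finset.univ.filter fun i => x i ≠ 0).exists_min_image
    (fun i => |w i / x i|) ⟨i₀, by simpa using hi₀⟩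
  have hxi : x i ≠ 0 := by simpa using hi
  refine ⟨w i / x i, ⟨i, hxi, by field_simp; ring⟩, fun j => ?_⟩
  have hle : |w i / x i * x j| ≤ |w j| := by
    by_cases hj : x j = 0
    · simp [hj]
    · rw [abs_mul]
      refine (mul_le_mul_of_nonneg_right (hmin j (by simpa using hj)) (abs_nonneg _)).trans ?_
      rw [← abs_mul, div_mul_cancel₀ _ hj]
  have h := mul_le_mul_of_nonneg_left hle (abs_nonneg (w j))
  rw [← abs_mul, abs_mul_abs_self] at h
  linarith [le_abs_self (w j * (w i / x i * x j))]

/-- A nonzero vector in the kernel of a `k`-row matrix with positive maximal minors has at least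
`k` sign changes. -/
lemma PosRowMinors.exists_alternating_of_mulVec_eq_zero {k n : ℕ}
    {C : Matrix (Fin k) (Fin n) ℝ} (hC : PosRowMinors C) (hkn : k ≤ n) (w : Fin n → ℝ)
    (hw : C.mulVec w = 0) (hw0 : w ≠ 0) :
    ∃ q : Fin (k + 1) → Fin n, StrictMono q ∧
      ∃ ε : ℝ, ∀ i : Fin (k + 1), 0 < ε * (-1) ^ (i : ℕ) * w (q i) := by
  induction hN : (Finset.univ.filter fun i => w i ≠ 0).card using Nat.strong_induction_on
    generalizing w with
  | _ N ih =>
  have hcard : k + 1 ≤ (Finset.univ.filter fun i => w i ≠ 0).card := by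
    by_contra h
    exact hw0 (hC.eq_zero_of_card_support_le hkn hw (by lia))
  obtain ⟨S, hS, hSk⟩ := Finset.exists_subset_card_eq hcard
  let q := S.orderEmbOfFin hSk
  have hqw : ∀ i, w (q i) ≠ 0 := fun i => by
    simpa using hS (S.orderEmbOfFin_mem hSk i)
  obtain ⟨Δ, hΔ, hrel⟩ := hC.exists_alternating_relation q.strictMono
  let x : Fin n → ℝ := Function.extend q (fun i => (-1) ^ (i : ℕ) * Δ i) 0
  have hxq : ∀ i, x (q i) = (-1) ^ (i : ℕ) * Δ i := fun i => q.injective.extend_apply _ _ _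
  have hxoff : ∀ j, j ∉ Set.range q → x j = 0 := fun j hj =>
    Function.extend_apply' _ _ _ hj
  have hxw : ∀ j, w j = 0 → x j = 0 := fun j hj =>
    hxoff j (by rintro ⟨i, rfl⟩; exact hqw i hj)
  have hx0 : x ≠ 0 := fun h => by
    have := congrFun h (q 0)
    rw [hxq] at this
    simp [(hΔ 0).ne'] at this
  have hCx : C.mulVec x = 0 := by
    ext a
    rw [Pi.zero_apply, ← hrel a]
    exact (Fintype.sum_of_injective q q.injective _ _
      (fun j hj => by simp [hxoff j hj]) fun i => by rw [hxq]; ring).symm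
  obtain ⟨t, ⟨i₀, hxi₀, hi₀⟩, hconf⟩ := exists_sub_smul_conformal (w := w) hx0
  by_cases hw' : w - t • x = 0
  · have hwt : ∀ j, w j = t * x j := fun j => by
      simpa [sub_eq_zero] using congrFun hw' j
    have ht : t ≠ 0 := by
      rintro rfl
      exact hw0 (by ext j; simp [hwt j])
    refine ⟨q, q.strictMono, t, fun i => ?_⟩
    rw [hwt, hxq]
    have : t * (-1) ^ (i : ℕ) * (t * ((-1) ^ (i : ℕ) * Δ i)) = (t * (-1) ^ (i : ℕ)) ^ 2 * Δ i := by
      ring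
    rw [this]
    have := hΔ i
    positivity
  · obtain ⟨p, hp, ε, hε⟩ := ih _ (by
      rw [← hN]
      refine Finset.card_lt_card (Finset.ssubset_iff_of_subset ?_ |>.mpr ⟨i₀, ?_, ?_⟩)
      · intro j
        simp only [Finset.mem_filter, Finset.mem_univ, true_and]
        intro hj h
        exact hj (by simp [h, hxw j h])
      · simpa using fun h => hxi₀ (hxw i₀ h)
      · simpa using hi₀) (w - t • x)
      (by rw [Matrix.mulVec_sub, Matrix.mulVec_smul, hw, hCx]; simp) hw' rfl
    refine ⟨p, hp, ε, fun i => ?_⟩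
    have h1 := hε i
    have h2 := hconf (p i)
    simp only [Pi.sub_apply, Pi.smul_apply, smul_eq_mul] at h1
    have h3 : w (p i) ≠ 0 := fun h => by simp [h, hxw _ h] at h1
    have h4 : w (p i) - t * x (p i) ≠ 0 := fun h => by simp [h] at h1
    have h5 : 0 < w (p i) * (w (p i) - t * x (p i)) := lt_of_le_of_ne h2 (mul_ne_zero h3 h4).symm
    refine pos_of_mul_pos_left (b := (w (p i) - t * x (p i)) ^ 2) ?_ (by positivity)
    calc 0 < _ := mul_pos h1 h5
      _ = _ := by ring

/-- A vector in the row space of a `k`-row matrix with positive maximal minors has no weakly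
alternating subsequence of length `k + 1`, unless it is zero. -/
lemma PosRowMinors.eq_zero_of_weakly_alternating {k n : ℕ} {C : Matrix (Fin k) (Fin n) ℝ}
    (hC : PosRowMinors C) (v : Fin k → ℝ) {q : Fin (k + 1) → Fin n} (hq : StrictMono q)
    {ε : ℝ} (hε0 : ε ≠ 0)
    (hε : ∀ i : Fin (k + 1), 0 ≤ ε * (-1) ^ (i : ℕ) * Matrix.vecMul v C (q i)) : v = 0 := by
  obtain ⟨Δ, hΔ, hrel⟩ := hC.exists_alternating_relation hq
  have hsum : ∑ i : Fin (k + 1), Δ i * (ε * (-1) ^ (i : ℕ) * Matrix.vecMul v C (q i)) = 0 := by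
    calc _ = ∑ i : Fin (k + 1), ∑ a, ε * v a * ((-1) ^ (i : ℕ) * Δ i * C a (q i)) := by
          refine Finset.sum_congr rfl fun i _ => ?_
          simp only [Matrix.vecMul, dotProduct, Finset.mul_sum]
          exact Finset.sum_congr rfl fun a _ => by ring
      _ = 0 := by
          rw [Finset.sum_comm]
          exact Finset.sum_eq_zero fun a _ => by rw [← Finset.mul_sum, hrel, mul_zero]
  rw [Finset.sum_eq_zero_iff_of_nonneg fun i _ => mul_nonneg (hΔ i).le (hε i)] at hsum
  have hz : ∀ i, Matrix.vecMul v C (q i) = 0 := fun i => by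
    simpa [(hΔ i).ne', hε0] using hsum i (Finset.mem_univ i)
  refine Matrix.eq_zero_of_vecMul_eq_zero
    (hC (q ∘ Fin.castSucc) (hq.comp Fin.strictMono_castSucc)).ne' ?_
  ext b
  exact hz b.castSucc

lemma PosMaximalMinors.transpose {n p : ℕ} {Z : Matrix (Fin n) (Fin p) ℝ}
    (hZ : PosMaximalMinors Z) : PosRowMinors Z.transpose := fun g hg => by
  rw [← Matrix.det_transpose]
  exact hZ g hg

/-- The rows of `C * Z` are linearly independent. -/
lemma PosRowMinors.eq_zero_of_vecMul_mul_eq_zero {k p n : ℕ} {C : Matrix (Fin k) (Fin n) ℝ}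
    (hC : PosRowMinors C) {Z : Matrix (Fin n) (Fin p) ℝ} (hZ : PosMaximalMinors Z)
    (hkp : k ≤ p) (hpn : p ≤ n) {c : Fin k → ℝ} (hc : Matrix.vecMul c (C * Z) = 0) : c = 0 := by
  by_cases hu : Matrix.vecMul c C = 0
  · let q : Fin k → Fin n := Fin.castLE (hkp.trans hpn)
    refine Matrix.eq_zero_of_vecMul_eq_zero (hC q (Fin.strictMono_castLE _)).ne' ?_
    ext b
    exact congrFun hu (q b)
  · obtain ⟨q, hq, ε, hε⟩ := hZ.transpose.exists_alternating_of_mulVec_eq_zero hpn _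
      (by rw [Matrix.mulVec_transpose, Matrix.vecMul_vecMul, hc]) hu
    refine hC.eq_zero_of_weakly_alternating c
      (hq.comp (Fin.strictMono_castLE (Nat.add_le_add_right hkp 1))) (ε := ε) ?_ fun i => (hε (Fin.castLE _ i)).le
    rintro rfl
    simpa using hε 0

/-- An index outside a list of consecutive pairs exceeds an even number of its entries. -/
lemma ConsecPairs.even_card_lt {r n : ℕ} {J : Fin (2 * r) → Fin n} (hJ : StrictMono J)
    (hpair : ConsecPairs J) {x : Fin n} (hx : x ∉ Set.range J) :
    Even ((Finset.univ.image J).filter (· < x)).card := by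
  rw [Finset.filter_image, Finset.card_image_of_injective _ hJ.injective]
  set T := Finset.univ.filter fun b => J b < x with hT
  have hmem : ∀ b, b ∈ T ↔ (b : ℕ) < T.card := by
    have hlow : ∀ a b, b ∈ T → a ≤ b → a ∈ T := fun a b hb hab => by
      simp only [hT, Finset.mem_filter, Finset.mem_univ, true_and] at hb ⊢
      exact (hJ.monotone hab).trans_lt hb
    intro b
    constructor
    · intro hb
      have := Finset.card_le_card (s := Finset.Iic b) (t := T)
        fun a ha => hlow a b hb (Finset.mem_Iic.mp ha)
      rw [Fin.card_Iic] at this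
      lia
    · intro hb
      by_contra hbT
      have := Finset.card_le_card (s := T) (t := Finset.Iio b) fun a ha =>
        Finset.mem_Iio.mpr (lt_of_not_ge fun h => hbT (hlow b a ha h))
      rw [Fin.card_Iio] at this
      lia
  by_contra hodd
  rw [Nat.not_even_iff] at hodd
  have hle : T.card ≤ 2 * r := by simpa using Finset.card_le_univ T
  let a : Fin (2 * r) := ⟨T.card - 1, by lia⟩
  let b : Fin (2 * r) := ⟨T.card, by lia⟩
  have ha : a ∈ T := (hmem a).mpr (by simp only [a]; lia)
  have hb : b ∉ T := fun h => by simpa [b] using (hmem b).mp h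
  have hab := hpair a b (by simp only [a, b]; lia) (by simp only [a]; lia)
  simp only [hT, Finset.mem_filter, Finset.mem_univ, true_and, not_lt] at ha hb
  refine hx ⟨b, ?_⟩
  ext
  rw [Fin.lt_def] at ha
  rw [Fin.le_def] at hb
  lia

/-- The position of an entry in the increasing enumeration of a finset is the number of smaller
elements. -/
lemma Finset.card_filter_lt_orderEmbOfFin {α : Type*} [LinearOrder α] (S : Finset α) {N : ℕ}
    (h : S.card = N) (i : Fin N) :
    (S.filter (· < S.orderEmbOfFin h i)).card = i := by
  have : S.filter (· < S.orderEmbOfFin h i) = (Finset.Iio i).map (S.orderEmbOfFin h).toEmbedding := by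
    ext y
    simp only [Finset.mem_filter, Finset.mem_map, Finset.mem_Iio]
    constructor
    · rintro ⟨hy, hlt⟩
      rw [← Finset.mem_coe, ← Finset.range_orderEmbOfFin S h] at hy
      obtain ⟨j, rfl⟩ := hy
      exact ⟨j, by simpa using hlt, rfl⟩
    · rintro ⟨j, hj, rfl⟩
      exact ⟨S.orderEmbOfFin_mem h j, by simpa using hj⟩
  rw [this, Finset.card_map, Fin.card_Iio]

/-- Inserting consecutive pairs of zeros into an alternating subsequence lengthens it. -/
lemma exists_weakly_alternating_of_consecPairs {l r n : ℕ} {w : Fin n → ℝ}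
    {J : Fin (2 * r) → Fin n} (hJ : StrictMono J) (hpair : ConsecPairs J) (hwJ : ∀ b, w (J b) = 0)
    {p : Fin l → Fin n} (hp : StrictMono p) {ε : ℝ}
    (hε : ∀ i : Fin l, 0 < ε * (-1) ^ (i : ℕ) * w (p i)) :
    ∃ q : Fin (l + 2 * r) → Fin n, StrictMono q ∧
      ∀ i : Fin (l + 2 * r), 0 ≤ ε * (-1) ^ (i : ℕ) * w (q i) := by
  have hpJ : ∀ i, p i ∉ Set.range J := by
    rintro i ⟨b, hb⟩
    have := hε i
    simp [← hb, hwJ] at this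
  have hdisj : Disjoint (Finset.univ.image p) (Finset.univ.image J) := by
    rw [Finset.disjoint_left]
    intro x hx hxJ
    obtain ⟨i, -, rfl⟩ := Finset.mem_image.mp hx
    exact hpJ i (by simpa using hxJ)
  set S := Finset.univ.image p ∪ Finset.univ.image J with hS
  have hcard : S.card = l + 2 * r := by
    rw [hS, Finset.card_union_of_disjoint hdisj, Finset.card_image_of_injective _ hp.injective,
      Finset.card_image_of_injective _ hJ.injective]
    simp
  refine ⟨S.orderEmbOfFin hcard, (S.orderEmbOfFin hcard).strictMono, fun i => ?_⟩
  rcases Finset.mem_union.mp (S.orderEmbOfFin_mem hcard i) with h | h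
  · obtain ⟨j, -, hj⟩ := Finset.mem_image.mp h
    have hi := S.card_filter_lt_orderEmbOfFin hcard i
    have hlt : ((Finset.univ.image p).filter (· < p j)).card = j := by
      rw [Finset.filter_image, Finset.card_image_of_injective _ hp.injective]
      simp [hp.lt_iff_lt, Finset.filter_gt_eq_Iio]
    rw [← hj, hS, Finset.filter_union, Finset.card_union_of_disjoint
      (Finset.disjoint_filter_filter hdisj), hlt] at hi
    rw [← hi, pow_add, (hpair.even_card_lt hJ (hpJ j)).neg_one_pow, mul_one, ← hj]
    exact (hε j).le
  · obtain ⟨b, -, hb⟩ := Finset.mem_image.mp h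
    simp [← hb, hwJ]

/-- If `Y` has independent rows and every twistor coordinate on a sublist of `J` obtained by
removing one entry vanishes, then a nonzero vector is annihilated by `Y` and all the rows `Z_j`
with `j` in `J`. -/
lemma exists_mulVec_eq_zero_of_twistor_eq_zero_s14 {k m n : ℕ} {Z : Matrix (Fin n) (Fin (k + m)) ℝ}
    {Y : Matrix (Fin k) (Fin (k + m)) ℝ} (hY : ∀ c, Matrix.vecMul c Y = 0 → c = 0)
    {J : Fin (m + 1) → Fin n} (h : ∀ t : Fin (m + 1), twistor Z Y (fun a => J (t.succAbove a)) = 0) :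
    ∃ v ≠ 0, Y.mulVec v = 0 ∧ ∀ b, Z.mulVec v (J b) = 0 := by
  let M : Matrix (Fin k ⊕ Fin (m + 1)) (Fin (k + m)) ℝ :=
    Matrix.of (Sum.elim (fun a => Y a) fun b => Z (J b))
  obtain ⟨c, hc, hc0⟩ := Submodule.exists_mem_ne_zero_of_ne_bot
    (LinearMap.ker_ne_bot_of_finrank_lt (f := M.vecMulLinear) (by simp))
  have hrel : Matrix.vecMul c M = 0 := hc
  have hrel' : ∀ v : Fin (k + m) → ℝ,
      ∑ a, c (Sum.inl a) * Y.mulVec v a + ∑ b, c (Sum.inr b) * Z.mulVec v (J b) = 0 := by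
    intro v
    have := Matrix.dotProduct_mulVec c M v
    rw [hrel, zero_dotProduct] at this
    simpa [dotProduct, Fintype.sum_sum_type, M, Matrix.mulVec] using this
  obtain ⟨t, ht⟩ : ∃ t, c (Sum.inr t) ≠ 0 := by
    by_contra! hall
    have hl : (fun a => c (Sum.inl a)) = 0 := hY _ (by
      ext j
      simpa [Matrix.vecMul, dotProduct, Fintype.sum_sum_type, M, hall] using congrFun hrel j)
    refine hc0 (funext fun i => ?_)
    rcases i with a | b
    · exact congrFun hl a
    · exact hall b
  obtain ⟨u, hu0, hu⟩ := Matrix.exists_mulVec_eq_zero_iff.mpr (h t)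
  let v : Fin (k + m) → ℝ := u ∘ finSumFinEquiv.symm
  have hsum : ∀ f : Fin (k + m) → ℝ, ∑ j, f (finSumFinEquiv j) * u j = f ⬝ᵥ v := fun f => by
    rw [dotProduct, ← Equiv.sum_comp finSumFinEquiv]
    simp [v]
  have hYv : Y.mulVec v = 0 := by
    ext a
    have := congrFun hu (Sum.inl a)
    simpa only [Matrix.mulVec, dotProduct, Matrix.of_apply, Sum.elim_inl, hsum, Pi.zero_apply] using this
  have hZv : ∀ b, Z.mulVec v (J (t.succAbove b)) = 0 := fun b => by
    have := congrFun hu (Sum.inr b)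
    simpa only [Matrix.mulVec, dotProduct, Matrix.of_apply, Sum.elim_inr, hsum, Pi.zero_apply] using this
  refine ⟨v, fun hv => hu0 ?_, hYv, fun b => ?_⟩
  · ext j
    simpa [v] using congrFun hv (finSumFinEquiv j)
  · have := hrel' v
    rw [Fin.sum_univ_succAbove _ t] at this
    have htz : Z.mulVec v (J t) = 0 := by simpa [hYv, hZv, ht] using this
    rcases Fin.eq_self_or_eq_succAbove t b with rfl | ⟨b, rfl⟩
    · exact htz
    · exact hZv b

/-- Full dimensionality of simplices (twistor form): for `m = 2r+1` odd, `Z`, `C` with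
positive maximal minors, `Y = C Z`, and `J = (i_1, i_1+1, …, i_{r+1}, i_{r+1}+1)` a strictly
increasing pair list of length `2r+2 = m+1`, it is impossible that `⟨Y, L⟩ = 0` for every
`m`-element sublist `L` of `J` (i.e. `J` obtained by removing one entry). -/
theorem stmt14 (k r n : ℕ) (hmn : k + (2 * r + 1) ≤ n)
    (Z : Matrix (Fin n) (Fin (k + (2 * r + 1))) ℝ) (hZ : PosMaximalMinors Z)
    (C : Matrix (Fin k) (Fin n) ℝ) (hC : PosRowMinors C)
    (J : Fin (2 * r + 2) → Fin n) (hJ : StrictMono J) (hpair : ConsecPairs J) :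
    ¬ ∀ t : Fin (2 * r + 2),
        twistor Z (C * Z) (fun a => J (t.succAbove a)) = 0 := by
  intro h
  obtain ⟨v, hv0, hYv, hJv⟩ := exists_mulVec_eq_zero_of_twistor_eq_zero_s14
    (fun c => hC.eq_zero_of_vecMul_mul_eq_zero hZ (by lia) hmn) h
  rw [← Matrix.mulVec_mulVec] at hYv
  have hvec : Matrix.vecMul v Z.transpose = Z.mulVec v := Matrix.vecMul_transpose Z v
  have hw0 : Z.mulVec v ≠ 0 := fun hw => by
    refine hv0 (Matrix.eq_zero_of_mulVec_eq_zero
      (hZ (Fin.castLE hmn) (Fin.strictMono_castLE hmn)).ne' ?_)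
    ext b
    exact congrFun hw (Fin.castLE hmn b)
  obtain ⟨p, hp, ε, hε⟩ := hC.exists_alternating_of_mulVec_eq_zero (by lia) _ hYv hw0
  obtain ⟨q, hq, hqε⟩ :=
    exists_weakly_alternating_of_consecPairs (r := r + 1) hJ hpair hJv hp hε
  refine hv0 (hZ.transpose.eq_zero_of_weakly_alternating v
    (hq.comp (Fin.strictMono_castLE (by lia))) (ε := ε) ?_ fun i => ?_)
  · rintro rfl
    simpa using hε 0
  · rw [hvec]
    exact hqε (Fin.castLE _ i)
end

section
/- Let k, m, n with m even and n = k+m. Let Z ∈ Mat_{n,n} with det Z > 0, let C be a k×n matrix with all k×k minors positive, Y = CZ, and let I = (i_1, i_1+1, ..., i_{m/2}, i_{m/2}+1) be strictly ascending in [n]. Let Z_* = Z_n + μZ_{n−1} + ... + μ^{m−1}Z_{n−m+1} for sufficiently small μ > 0. Then for j ∈ {1,...,m/2} and ε ∈ {0,1}, sign⟨Y, Z_*, I∖{i_j+ε}⟩ = (−1)^{k + i_j + (1−ε)}. -/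
/-- The square matrix whose first rows are those of `C` and whose remaining rows are `R`. -/
def stackRows {k m : ℕ} (C : Matrix (Fin k) (Fin (k + m)) ℝ) (R : Fin m → Fin (k + m) → ℝ) :
    Matrix (Fin (k + m)) (Fin (k + m)) ℝ :=
  Matrix.of (Fin.append C R)

@[simp]
lemma stackRows_castAdd {k m : ℕ} (C : Matrix (Fin k) (Fin (k + m)) ℝ)
    (R : Fin m → Fin (k + m) → ℝ) (i : Fin k) : stackRows C R (Fin.castAdd m i) = C i :=
  Fin.append_left (α := Fin (k + m) → ℝ) C R i

@[simp]
lemma stackRows_natAdd {k m : ℕ} (C : Matrix (Fin k) (Fin (k + m)) ℝ)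
    (R : Fin m → Fin (k + m) → ℝ) (i : Fin m) : stackRows C R (Fin.natAdd k i) = R i :=
  Fin.append_right (α := Fin (k + m) → ℝ) C R i

/-- Stacking a matrix with positive maximal minors on the unit vectors at increasing
positions `J` gives a determinant of sign `(-1) ^ ∑ a, (k + a + J a)`. -/
lemma PosRowMinors.det_stackRows_single_pos {k m : ℕ} {C : Matrix (Fin k) (Fin (k + m)) ℝ}
    (hC : PosRowMinors C) {J : Fin m → Fin (k + m)} (hJ : StrictMono J) :
    0 < (-1 : ℝ) ^ (∑ a : Fin m, (k + (a : ℕ) + (J a : ℕ))) *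
      (stackRows C fun a => Pi.single (J a) 1).det := by
  induction m with
  | zero =>
    have h := hC id strictMono_id
    have hEq : (stackRows C fun a => Pi.single (J a) 1) =
        Matrix.of fun a b => C a (id b) := by
      ext i j
      exact congrFun (stackRows_castAdd C _ i) j
    rw [hEq]
    simpa using h
  | succ m ih =>
    have hlt : ∀ a : Fin m, J a.castSucc < J (Fin.last m) :=
      fun a => hJ (Fin.castSucc_lt_last a)
    set q : Fin (k + m + 1) := J (Fin.last m) with hq
    let C' : Matrix (Fin k) (Fin (k + m)) ℝ := Matrix.of fun a b => C a (q.succAbove b)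
    have hC' : PosRowMinors C' := fun g hg =>
      hC (fun b => q.succAbove (g b)) ((Fin.strictMono_succAbove q).comp hg)
    let J' : Fin m → Fin (k + m) := fun a =>
      ⟨J a.castSucc, by have := hlt a; have := q.isLt; simp only [Fin.lt_def] at *; omega⟩
    have hJ' : StrictMono J' := fun a b hab =>
      Fin.lt_def.mp (hJ (Fin.castSucc_lt_castSucc_iff.mpr hab))
    have hJs : ∀ a, q.succAbove (J' a) = J a.castSucc := fun a =>
      Fin.succAbove_of_castSucc_lt q (J' a) (hlt a)
    have key := ih hC' hJ'
    have hdet : (stackRows C fun a => Pi.single (J a) 1).det =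
        (-1 : ℝ) ^ (k + m + (q : ℕ)) * (stackRows C' fun a => Pi.single (J' a) 1).det := by
      have hrow : (stackRows C fun a => Pi.single (J a) 1) (Fin.last (k + m)) =
          Pi.single q 1 := stackRows_natAdd C _ (Fin.last m)
      refine (Matrix.det_succ_row (n := k + m) _ (Fin.last (k + m))).trans ?_
      rw [Finset.sum_eq_single q]
      · rw [hrow, Pi.single_eq_same, mul_one, Fin.val_last]
        congr 2
        ext i j
        rw [Matrix.submatrix_apply, Fin.succAbove_last]
        refine Fin.addCases (fun i => ?_) (fun i => ?_) i
        · rw [stackRows_castAdd]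
          exact congrFun (stackRows_castAdd C _ i) _
        · rw [stackRows_natAdd]
          refine (congrFun (stackRows_natAdd C _ i.castSucc) _).trans ?_
          rw [← hJs, Pi.single_apply, Pi.single_apply]
          simp only [(Fin.succAbove_right_injective (p := q)).eq_iff]
      · intro b _ hb
        rw [hrow, Pi.single_eq_of_ne hb]
        simp
      · simp
    have hs : (-1 : ℝ) ^ (k + m + (q : ℕ)) * (-1) ^ (k + m + (q : ℕ)) = 1 := by
      rw [← mul_pow]; simp
    rw [hdet, Fin.sum_univ_castSucc, pow_add, ← hq, Fin.val_last, mul_assoc,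
      ← mul_assoc _ _ (Matrix.det _), hs, one_mul]
    exact key

/-- Rotating the first appended row into position `p` multiplies the determinant by `(-1) ^ p`. -/
lemma det_stackRows_cons {k N : ℕ} (C : Matrix (Fin k) (Fin (k + (N + 1))) ℝ)
    (p : Fin (N + 1)) (v : Fin (k + (N + 1)) → ℝ) (R : Fin N → Fin (k + (N + 1)) → ℝ) :
    (stackRows C (Fin.cons v R)).det =
      (-1 : ℝ) ^ (p : ℕ) * (stackRows C (p.insertNth v R)).det := by
  let τ : Equiv.Perm (Fin k ⊕ Fin (N + 1)) := Equiv.sumCongr 1 p.cycleRange.symm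
  have hτ : (stackRows C (Fin.cons v R)) =
      (stackRows C (p.insertNth v R)).submatrix
        (finSumFinEquiv.permCongr τ) id := by
    ext i j
    refine Fin.addCases (fun i => ?_) (fun i => ?_) i
    · simp [τ, Equiv.permCongr_apply]
    · simp [τ, Equiv.permCongr_apply, Fin.insertNth_apply_cycleRange_symm]
  rw [hτ, Matrix.det_permute]
  simp [τ, Equiv.Perm.sign_permCongr, Equiv.Perm.sign_sumCongr, Fin.sign_cycleRange]

/-- Linearity of the determinant in the first appended row. -/
lemma det_stackRows_cons_sum {k N : ℕ} (C : Matrix (Fin k) (Fin (k + (N + 1))) ℝ)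
    {ι : Type*} (S : Finset ι) (c : ι → ℝ) (v : ι → Fin (k + (N + 1)) → ℝ)
    (R : Fin N → Fin (k + (N + 1)) → ℝ) :
    (stackRows C (Fin.cons (∑ s ∈ S, c s • v s) R)).det =
      ∑ s ∈ S, c s * (stackRows C (Fin.cons (v s) R)).det := by
  have hupd : ∀ w, stackRows C (Fin.cons w R) =
      (stackRows C (Fin.cons 0 R)).updateRow (Fin.natAdd k 0) w := by
    intro w
    ext i j
    refine Fin.addCases (fun i => ?_) (fun i => ?_) i
    · rw [Matrix.updateRow_ne (by simp [Fin.ext_iff]; omega)]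
      simp
    · refine Fin.cases ?_ (fun i => ?_) i
      · simp
      · rw [Matrix.updateRow_ne (by simp [Fin.ext_iff])]
        simp
  let f := Matrix.detRowAlternating.toMultilinearMap.toLinearMap
    (stackRows C (Fin.cons 0 R)) (Fin.natAdd k 0)
  have hf : ∀ w, (stackRows C (Fin.cons w R)).det = f w := fun w => by rw [hupd]; rfl
  simp only [hf, map_sum, map_smul, smul_eq_mul]

/-- An increasing sequence missing one entry can be completed by the largest value not
already hit; that value is inserted at the matching position. -/
lemma exists_strictMono_insertNth {k N : ℕ} {L : Fin N → Fin (k + (N + 1))}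
    (hL : StrictMono L) :
    ∃ p : Fin (N + 1), (∀ p', p < p' → Fin.natAdd k p' ∈ Set.range L) ∧
      StrictMono (p.insertNth (α := fun _ => Fin (k + (N + 1))) (Fin.natAdd k p) L) := by
  let P : ℕ → Prop := fun p => ∀ b : Fin N, p ≤ b → (L b : ℕ) = k + b + 1
  have hex : ∃ p, P p := ⟨N, fun b hb => absurd b.isLt (by omega)⟩
  have hle : ∀ d : ℕ, ∀ b : Fin N, N = b + 1 + d → (L b : ℕ) ≤ k + b + 1 := by
    intro d
    induction d with
    | zero => intro b hb; have := (L b).isLt; omega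
    | succ d ih =>
      intro b hb
      have h1 := ih ⟨b + 1, by omega⟩ (by simp only; omega)
      have h2 : L b < L ⟨b + 1, by omega⟩ := hL (by simp [Fin.lt_def])
      simp only [Fin.lt_def] at h1 h2
      omega
  have hp : P (Nat.find hex) := Nat.find_spec hex
  have hpN : Nat.find hex ≤ N := Nat.find_min' hex fun b hb => absurd b.isLt (by omega)
  have hmin : ∀ b : Fin N, (b : ℕ) < Nat.find hex → (L b : ℕ) < k + Nat.find hex := by
    intro b hb
    have hnot : ¬ P (Nat.find hex - 1) := Nat.find_min hex (by omega)
    simp only [P, not_forall] at hnot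
    obtain ⟨c, hc, hne⟩ := hnot
    have hcp : (c : ℕ) < Nat.find hex := by
      by_contra h
      exact hne (hp c (by omega))
    have h1 := hle (N - c - 1) c (by omega)
    have h2 : L b ≤ L c := hL.monotone (by rw [Fin.le_def]; omega)
    rw [Fin.le_def] at h2
    omega
  generalize Nat.find hex = q at *
  refine ⟨⟨q, by omega⟩, fun p' hp' => ?_, ?_⟩
  · replace hp' : q < (p' : ℕ) := hp'
    refine ⟨⟨p' - 1, by omega⟩, Fin.ext ?_⟩
    have := hp ⟨p' - 1, by omega⟩ (by simp only at *; omega)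
    simp only [Fin.val_natAdd] at *
    omega
  · intro a b hab
    have hcase : ∀ c : Fin N,
        ((Fin.succAbove (⟨q, by omega⟩ : Fin (N + 1)) c : Fin (N + 1)) : ℕ) =
        if (c : ℕ) < q then (c : ℕ) else c + 1 := fun c => by
      simp only [Fin.succAbove, Fin.lt_def, Fin.val_castSucc]
      split_ifs <;> simp
    induction a using Fin.succAboveCases (⟨q, by omega⟩ : Fin (N + 1)) with
    | x =>
      induction b using Fin.succAboveCases (⟨q, by omega⟩ : Fin (N + 1)) with
      | x => exact absurd hab (lt_irrefl _)
      | p c =>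
        rw [Fin.insertNth_apply_same, Fin.insertNth_apply_succAbove]
        rw [Fin.lt_def, hcase] at hab
        have := hp c
        rw [Fin.lt_def, Fin.val_natAdd]
        split_ifs at hab <;> simp only at * <;> omega
    | p c =>
      induction b using Fin.succAboveCases (⟨q, by omega⟩ : Fin (N + 1)) with
      | x =>
        rw [Fin.insertNth_apply_same, Fin.insertNth_apply_succAbove]
        rw [Fin.lt_def, hcase] at hab
        have := hmin c
        rw [Fin.lt_def, Fin.val_natAdd]
        split_ifs at hab <;> simp only at * <;> omega
      | p d =>
        rw [Fin.insertNth_apply_succAbove, Fin.insertNth_apply_succAbove]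
        exact hL ((Fin.strictMono_succAbove _).lt_iff_lt.mp hab)

/-- A sum over consecutive pairs with even pair sums is even. -/
lemma even_sum_of_even_pairs {M : ℕ} {f : Fin (2 * M) → ℕ}
    (hf : ∀ a b : Fin (2 * M), (a : ℕ) + 1 = b → (a : ℕ) % 2 = 0 → Even (f a + f b)) :
    Even (∑ a, f a) := by
  induction M with
  | zero => simp
  | succ M ih =>
    have hsum : ∑ a, f a = ∑ a : Fin (2 * M), f a.castSucc.castSucc +
        (f (Fin.last (2 * M)).castSucc + f (Fin.last (2 * M + 1))) := by
      rw [← add_assoc]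
      exact (Fin.sum_univ_castSucc (n := 2 * M + 1) f).trans
        (congrArg (· + _) (Fin.sum_univ_castSucc _))
    rw [hsum]
    exact (ih fun a b hab ha => hf _ _ hab ha).add (hf _ _ (by simp) (by simp))

/-- A finite power sum in `x` has, for small `x > 0`, the sign of its lowest-order coefficient. -/
lemma eventually_sign_sum_pow {m : ℕ} {c : Fin m → ℝ} {s₀ : Fin m} {e : ℕ}
    (hlow : ∀ s < s₀, c s = 0) (hpos : 0 < (-1 : ℝ) ^ e * c s₀) :
    ∀ᶠ x in nhdsWithin (0 : ℝ) (Set.Ioi 0),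
      0 < (-1 : ℝ) ^ e * ∑ s : Fin m, x ^ (s : ℕ) * c s := by
  let g : ℝ → ℝ := fun x => (-1 : ℝ) ^ e * ∑ s : Fin m, x ^ ((s : ℕ) - s₀) * c s
  have hg : Continuous g := by fun_prop
  have hg0 : g 0 = (-1 : ℝ) ^ e * c s₀ := by
    simp only [g]
    rw [Finset.sum_eq_single s₀]
    · simp
    · intro s _ hs
      rcases lt_or_gt_of_ne hs with h | h
      · simp [hlow s h]
      · rw [zero_pow (by rw [Fin.lt_def] at h; omega), zero_mul]
    · simp
  have hev : ∀ᶠ x in nhds (0 : ℝ), 0 < g x :=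
    hg.continuousAt.eventually (lt_mem_nhds (by rw [hg0]; exact hpos))
  filter_upwards [hev.filter_mono nhdsWithin_le_nhds, self_mem_nhdsWithin] with x hx hx0
  have hfac : (-1 : ℝ) ^ e * ∑ s : Fin m, x ^ (s : ℕ) * c s = x ^ (s₀ : ℕ) * g x := by
    simp only [g]
    rw [mul_left_comm, Finset.mul_sum _ _ (x ^ (s₀ : ℕ))]
    congr 1
    refine Finset.sum_congr rfl fun s _ => ?_
    by_cases h : s < s₀
    · simp [hlow s h]
    · rw [← mul_assoc, ← pow_add, Nat.add_sub_cancel' (by rw [Fin.lt_def] at h; omega)]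
  rw [hfac]
  exact mul_pos (pow_pos hx0 _) hx

lemma Real.sign_eq_neg_one_pow {e : ℕ} {x : ℝ} (h : 0 < (-1 : ℝ) ^ e * x) :
    Real.sign x = (-1 : ℝ) ^ e := by
  rcases neg_one_pow_eq_or ℝ e with he | he <;> rw [he] at h ⊢
  · exact Real.sign_of_pos (by linarith)
  · exact Real.sign_of_neg (by linarith)

/-- The sign of the determinant of `C`, the ray `∑ s, μ ^ s • e_{n-1-s}` and the unit vectors
at increasing positions `L`. -/
lemma PosRowMinors.eventually_det_stackRows_ray {k N : ℕ}
    {C : Matrix (Fin k) (Fin (k + (N + 1))) ℝ} (hC : PosRowMinors C)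
    {L : Fin N → Fin (k + (N + 1))} (hL : StrictMono L) :
    ∀ᶠ μ in nhdsWithin (0 : ℝ) (Set.Ioi 0),
      0 < (-1 : ℝ) ^ (k + ∑ a : Fin (N + 1), (k + (a : ℕ)) + ∑ b, (L b : ℕ)) *
        (stackRows C (Fin.cons
          (∑ s : Fin (N + 1), μ ^ (s : ℕ) • Pi.single (Fin.natAdd k s.rev) 1)
          fun b => Pi.single (L b) 1)).det := by
  obtain ⟨p, hrange, hmono⟩ := exists_strictMono_insertNth hL
  simp only [det_stackRows_cons_sum]
  refine eventually_sign_sum_pow (s₀ := p.rev) (fun s hs => ?_) ?_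
  · obtain ⟨b, hb⟩ := hrange s.rev (by rwa [Fin.lt_rev_iff])
    refine Matrix.det_zero_of_row_eq (i := Fin.natAdd k 0) (j := Fin.natAdd k b.succ)
      (by simp [Fin.ext_iff]) ?_
    simp [hb]
  · have h := hC.det_stackRows_single_pos hmono
    rw [Fin.rev_rev, det_stackRows_cons C p]
    have hins : (p.insertNth (Pi.single (Fin.natAdd k p) (1 : ℝ))
        fun b => Pi.single (L b) 1 : Fin (N + 1) → Fin (k + (N + 1)) → ℝ) =
        fun a => Pi.single
          (p.insertNth (α := fun _ => Fin (k + (N + 1))) (Fin.natAdd k p) L a) 1 := by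
      ext a
      induction a using Fin.succAboveCases p <;> simp
    rw [hins, ← mul_assoc, ← pow_add]
    have hsum : ∑ a, ((p.insertNth (α := fun _ => Fin (k + (N + 1))) (Fin.natAdd k p) L a :
        Fin (k + (N + 1))) : ℕ) = k + p + ∑ b, (L b : ℕ) := by
      rw [Fin.sum_univ_succAbove _ p]
      simp
    rw [Finset.sum_add_distrib, hsum] at h
    convert h using 3
    ring

/-- Sign computation for the ray vector `Z_* = Z_n + μ Z_{n−1} + ⋯ + μ^{m−1} Z_{n−m+1}`,
with `n = k + m`, `m = 2M+2` even, `det Z > 0`, `C` with positive maximal minors,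
`Y = C Z`, and `I = (i_1, i_1+1, …, i_{m/2}, i_{m/2}+1)` strictly increasing: for all
sufficiently small `μ > 0` and every position `t` of the list `I`,
`sign ⟨Y, Z_*, I ∖ {I t}⟩ = (−1)^{k + i_j + (1−ε)}` where the removed entry is `i_j + ε`;
in 0-indexed terms the right-hand side is `(−1)^{k + (I t).val}`. -/
theorem stmt17 (k M : ℕ)
    (Z : Matrix (Fin (k + (2 * M + 2))) (Fin (k + (2 * M + 2))) ℝ) (hZ : 0 < Z.det)
    (C : Matrix (Fin k) (Fin (k + (2 * M + 2))) ℝ) (hC : PosRowMinors C)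
    (I : Fin (2 * M + 2) → Fin (k + (2 * M + 2)))
    (hI : StrictMono I) (hpair : ConsecPairs I) :
    ∃ μ0 > (0 : ℝ), ∀ μ : ℝ, 0 < μ → μ < μ0 →
      ∀ t : Fin (2 * M + 2),
        Real.sign
          (Matrix.det (Matrix.of fun i j : Fin k ⊕ Fin (2 * M + 2) =>
            Sum.elim (fun a => (C * Z) a)
              (Fin.cons
                (fun c => ∑ s : Fin (2 * M + 2),
                  μ ^ (s : ℕ) * Z ⟨k + (2 * M + 2) - 1 - (s : ℕ), by omega⟩ c)
                (fun b => Z (I (t.succAbove b)))) i (finSumFinEquiv j))) =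
        (-1 : ℝ) ^ (k + (I t : ℕ)) := by
  have hev := fun t : Fin (2 * M + 2) =>
    hC.eventually_det_stackRows_ray (N := 2 * M + 1) (hI.comp (Fin.strictMono_succAbove t))
  obtain ⟨μ0, hμ0, hμ⟩ := mem_nhdsGT_iff_exists_Ioo_subset.mp (Filter.eventually_all.mpr hev)
  refine ⟨μ0, hμ0, fun μ h0 h1 t => Real.sign_eq_neg_one_pow ?_⟩
  have hpos := hμ ⟨h0, h1⟩ t
  have heven : Even (∑ a : Fin (2 * M + 2), (k + (a : ℕ) + (I a : ℕ))) :=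
    even_sum_of_even_pairs (M := M + 1) fun a b hab ha => by
      have := hpair a b hab ha
      rw [this, ← hab]
      exact ⟨k + a + I a + 1, by ring⟩
  have hsign : (-1 : ℝ) ^ (k + ∑ a : Fin (2 * M + 1 + 1), (k + (a : ℕ)) +
      ∑ b, ((I ∘ t.succAbove) b : ℕ)) = (-1 : ℝ) ^ (k + (I t : ℕ)) := by
    rw [Finset.sum_add_distrib, Fin.sum_univ_succAbove (fun a => (I a : ℕ)) t] at heven
    refine neg_one_pow_congr ?_
    simp only [Nat.even_add, Function.comp_apply] at heven ⊢
    tauto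
  rw [hsign] at hpos
  set B := stackRows C (Fin.cons
    (∑ s : Fin (2 * M + 1 + 1), μ ^ (s : ℕ) • Pi.single (Fin.natAdd k s.rev) 1)
    fun b => Pi.single ((I ∘ t.succAbove) b) 1) with hB
  have hmat : (Matrix.of fun i j : Fin k ⊕ Fin (2 * M + 2) =>
      Sum.elim (fun a => (C * Z) a)
        (Fin.cons
          (fun c => ∑ s : Fin (2 * M + 2),
            μ ^ (s : ℕ) * Z ⟨k + (2 * M + 2) - 1 - (s : ℕ), by omega⟩ c)
          (fun b => Z (I (t.succAbove b)))) i (finSumFinEquiv j)) =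
      (B * Z).submatrix finSumFinEquiv finSumFinEquiv := by
    ext i j
    rw [Matrix.submatrix_apply, Matrix.of_apply]
    generalize finSumFinEquiv j = c
    rcases i with i | i
    · simp [hB, Matrix.mul_apply]
    · refine Fin.cases ?_ (fun i => ?_) i
      · rw [Sum.elim_inr, Fin.cons_zero, finSumFinEquiv_apply_right, Matrix.mul_apply_eq_vecMul,
          hB, stackRows_natAdd, Fin.cons_zero, Matrix.sum_vecMul, Finset.sum_apply]
        refine Finset.sum_congr rfl fun s _ => ?_
        rw [Matrix.smul_vecMul, Matrix.single_one_vecMul, Pi.smul_apply, smul_eq_mul]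
        congr 2
        refine Fin.ext ?_
        simp only [Fin.val_natAdd, Fin.val_rev]
        omega
      · rw [Sum.elim_inr, Fin.cons_succ, finSumFinEquiv_apply_right, Matrix.mul_apply_eq_vecMul,
          hB, stackRows_natAdd, Fin.cons_succ, Matrix.single_one_vecMul]
        rfl
  rw [hmat, Matrix.det_submatrix_equiv_self, Matrix.det_mul, ← mul_assoc]
  exact mul_pos hpos hZ
end
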